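/- For every ℓ > 0, T > 0 and M > 0 there exists a constant C = C(ℓ,M,T) > 0 with the following property: let u, ǔ : ℝ × ℝ → ℝ³ be smooth maps, ℓ-periodic in the second variable, with |u| = |ǔ| = 1 everywhere, both solving ∂ₜu = ∂ₛ(u × ∂ₛu) and ∂ₜǔ = ∂ₛ(ǔ × ∂ₛǔ), with initial data u⁰ := u(0,·), ǔ⁰ := ǔ(0,·) satisfying ‖∂ₛₛₛu⁰‖₂ ≤ M and ‖∂ₛₛₛǔ⁰‖₂ ≤ M. Then for every t ∈ [−T,T]: ‖u(t,·) − ǔ(t,·)‖_{H¹}² ≤ C·‖u⁰ − ǔ⁰‖_{H¹}² and ‖u(t,·) − ǔ(t,·)‖_{H²}² ≤ C·‖u⁰ − ǔ⁰‖_{H²}², where ‖g‖_{H¹}² := ∫₀^ℓ (|g|² + |g'|²) ds and ‖g‖_{H²}² := ∫₀^ℓ (|g|² + |g'|² + |g''|²) ds. -/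

import Mathlib

noncomputable section
open Real MeasureTheory

/-- `ℝ³` as Euclidean space. -/
abbrev R3 : Type := EuclideanSpace ℝ (Fin 3)

/-- Pack three real numbers into a vector of `ℝ³`. -/
def toE (v : Fin 3 → ℝ) : R3 := (EuclideanSpace.equiv (Fin 3) ℝ).symm v

/-- The cross product on `ℝ³`. -/
def cross3 (a b : R3) : R3 :=
  toE ![a 1 * b 2 - a 2 * b 1, a 2 * b 0 - a 0 * b 2, a 0 * b 1 - a 1 * b 0]

section helpers
open Set Filter Topology
open scoped ContDiff

namespace SM

section calculus
variable {E : Type*} [NormedAddCommGroup E] [NormedSpace ℝ E]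

/-- joint smoothness of a function of time and space -/
def Sm (f : ℝ → ℝ → E) : Prop := ContDiff ℝ ∞ (fun p : ℝ × ℝ => f p.1 p.2)
/-- space derivative -/
def dS (f : ℝ → ℝ → E) : ℝ → ℝ → E := fun t s => deriv (f t) s
/-- time derivative -/
def dT (f : ℝ → ℝ → E) : ℝ → ℝ → E := fun t s => deriv (fun τ => f τ s) t
/-- spatial periodicity -/
def Per (l : ℝ) (f : ℝ → ℝ → E) : Prop := ∀ t s, f t (s + l) = f t s

theorem Sm.hS0 {f : ℝ → ℝ → E} (h : Sm f) (t s : ℝ) :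
    HasDerivAt (f t) (fderiv ℝ (fun p : ℝ × ℝ => f p.1 p.2) (t, s) (0, 1)) s := by
  have h1 : HasFDerivAt (fun p : ℝ × ℝ => f p.1 p.2)
      (fderiv ℝ (fun p : ℝ × ℝ => f p.1 p.2) (t, s)) (t, s) :=
    (ContDiff.differentiable h (by simp) (t, s)).hasFDerivAt
  have h2 : HasDerivAt (fun σ : ℝ => (t, σ)) ((0 : ℝ), (1 : ℝ)) s :=
    (hasDerivAt_const s t).prodMk (hasDerivAt_id s)
  exact HasFDerivAt.comp_hasDerivAt s h1 h2

theorem Sm.hT0 {f : ℝ → ℝ → E} (h : Sm f) (t s : ℝ) :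
    HasDerivAt (fun τ => f τ s) (fderiv ℝ (fun p : ℝ × ℝ => f p.1 p.2) (t, s) (1, 0)) t := by
  have h1 : HasFDerivAt (fun p : ℝ × ℝ => f p.1 p.2)
      (fderiv ℝ (fun p : ℝ × ℝ => f p.1 p.2) (t, s)) (t, s) :=
    (ContDiff.differentiable h (by simp) (t, s)).hasFDerivAt
  have h2 : HasDerivAt (fun τ : ℝ => (τ, s)) ((1 : ℝ), (0 : ℝ)) t :=
    (hasDerivAt_id t).prodMk (hasDerivAt_const t s)
  exact HasFDerivAt.comp_hasDerivAt t h1 h2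

theorem Sm.dS_eq {f : ℝ → ℝ → E} (h : Sm f) (t s : ℝ) :
    dS f t s = fderiv ℝ (fun p : ℝ × ℝ => f p.1 p.2) (t, s) (0, 1) := (h.hS0 t s).deriv
theorem Sm.dT_eq {f : ℝ → ℝ → E} (h : Sm f) (t s : ℝ) :
    dT f t s = fderiv ℝ (fun p : ℝ × ℝ => f p.1 p.2) (t, s) (1, 0) := (h.hT0 t s).deriv
theorem Sm.hS {f : ℝ → ℝ → E} (h : Sm f) (t s : ℝ) : HasDerivAt (f t) (dS f t s) s := by
  rw [h.dS_eq]; exact h.hS0 t s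
theorem Sm.hT {f : ℝ → ℝ → E} (h : Sm f) (t s : ℝ) :
    HasDerivAt (fun τ => f τ s) (dT f t s) t := by
  rw [h.dT_eq]; exact h.hT0 t s

theorem Sm.fd {f : ℝ → ℝ → E} (h : Sm f) :
    ContDiff ℝ ∞ (fderiv ℝ (fun p : ℝ × ℝ => f p.1 p.2)) :=
  ContDiff.fderiv_right h (by simp)

theorem Sm.dS {f : ℝ → ℝ → E} (h : Sm f) : Sm (dS f) := by
  have : (fun p : ℝ × ℝ => SM.dS f p.1 p.2)
      = fun p => fderiv ℝ (fun p : ℝ × ℝ => f p.1 p.2) p (0, 1) := by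
    funext p; exact h.dS_eq p.1 p.2
  unfold Sm; rw [this]; exact h.fd.clm_apply contDiff_const

theorem Sm.dT {f : ℝ → ℝ → E} (h : Sm f) : Sm (dT f) := by
  have : (fun p : ℝ × ℝ => SM.dT f p.1 p.2)
      = fun p => fderiv ℝ (fun p : ℝ × ℝ => f p.1 p.2) p (1, 0) := by
    funext p; exact h.dT_eq p.1 p.2
  unfold Sm; rw [this]; exact h.fd.clm_apply contDiff_const

theorem Sm.comm {f : ℝ → ℝ → E} (h : Sm f) : SM.dT (SM.dS f) = SM.dS (SM.dT f) := by
  funext t s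
  have hsym : IsSymmSndFDerivAt ℝ (fun p : ℝ × ℝ => f p.1 p.2) (t, s) :=
    (ContDiff.contDiffAt h).isSymmSndFDerivAt (by simp; exact WithTop.coe_le_coe.2 (le_top : (2 : ℕ∞) ≤ ⊤))
  have hd : DifferentiableAt ℝ (fderiv ℝ (fun p : ℝ × ℝ => f p.1 p.2)) (t, s) :=
    h.fd.differentiable (by simp) _
  rw [h.dS.dT_eq, h.dT.dS_eq]
  have e1 : (fun p : ℝ × ℝ => SM.dS f p.1 p.2)
      = fun p => fderiv ℝ (fun p : ℝ × ℝ => f p.1 p.2) p (0, 1) := by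
    funext p; exact h.dS_eq p.1 p.2
  have e2 : (fun p : ℝ × ℝ => SM.dT f p.1 p.2)
      = fun p => fderiv ℝ (fun p : ℝ × ℝ => f p.1 p.2) p (1, 0) := by
    funext p; exact h.dT_eq p.1 p.2
  rw [e1, e2, fderiv_clm_apply hd (differentiableAt_const _),
    fderiv_clm_apply hd (differentiableAt_const _)]
  simpa using hsym (1, 0) (0, 1)

theorem Sm.cont {f : ℝ → ℝ → E} (h : Sm f) (t : ℝ) : Continuous (f t) :=
  (ContDiff.continuous h).comp (by fun_prop : Continuous fun s : ℝ => (t, s))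

theorem Per.dS {l : ℝ} {f : ℝ → ℝ → E} (h : Per l f) : Per l (dS f) := by
  intro t s
  show deriv (f t) (s + l) = deriv (f t) s
  rw [← deriv_comp_add_const]
  congr 1; funext x; exact h t x

theorem Per.dT {l : ℝ} {f : ℝ → ℝ → E} (h : Per l f) : Per l (dT f) := by
  intro t s
  show deriv (fun τ => f τ (s + l)) t = _
  simp only [h _ s]; rfl

theorem Sm.add {f g : ℝ → ℝ → E} (hf : Sm f) (hg : Sm g) : Sm (fun t s => f t s + g t s) :=
  ContDiff.add hf hg
theorem Sm.sub {f g : ℝ → ℝ → E} (hf : Sm f) (hg : Sm g) : Sm (fun t s => f t s - g t s) :=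
  ContDiff.sub hf hg
theorem Sm.mul {f g : ℝ → ℝ → ℝ} (hf : Sm f) (hg : Sm g) : Sm (fun t s => f t s * g t s) :=
  ContDiff.mul hf hg
theorem Sm.const (c : E) : Sm (fun _ _ => c) := contDiff_const
end calculus

theorem integral_dS {l : ℝ} {f : ℝ → ℝ → ℝ} (h : Sm f) (hp : Per l f) (t : ℝ) :
    ∫ s in (0:ℝ)..l, dS f t s = 0 := by
  rw [intervalIntegral.integral_eq_sub_of_hasDerivAt (fun x _ => h.hS t x)
    ((h.dS.cont t).intervalIntegrable _ _)]
  have := hp t 0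
  simp only [zero_add] at this
  linarith

theorem hasDerivAt_int {l : ℝ} {f : ℝ → ℝ → ℝ} (h : Sm f) (t : ℝ) :
    HasDerivAt (fun t => ∫ s in (0:ℝ)..l, f t s) (∫ s in (0:ℝ)..l, dT f t s) t := by
  have hc : Continuous (fun p : ℝ × ℝ => dT f p.1 p.2) := ContDiff.continuous h.dT
  obtain ⟨K, hK⟩ := ((isCompact_closedBall t 1).prod (isCompact_uIcc (a := (0:ℝ)) (b := l))).exists_bound_of_continuousOn
    hc.continuousOn
  refine (intervalIntegral.hasDerivAt_integral_of_dominated_loc_of_deriv_le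
    (s := Metric.closedBall t 1) (bound := fun _ => K) (Metric.closedBall_mem_nhds t one_pos)
    (Eventually.of_forall fun x => (h.cont x).aestronglyMeasurable)
    ((h.cont t).intervalIntegrable _ _) (h.dT.cont t).aestronglyMeasurable
    (Eventually.of_forall fun s hs x hx => hK (x, s) ⟨hx, uIoc_subset_uIcc hs⟩)
    (by simp) (Eventually.of_forall fun s hs x hx => h.hT x s)).2

/-- energy identity: if the time derivative is `G` plus a space derivative -/
theorem energy {l : ℝ} {f G H : ℝ → ℝ → ℝ} (hf : Sm f) (hH : Sm H) (hp : Per l H)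
    (he : ∀ t s, dT f t s = G t s + dS H t s) (t : ℝ) :
    HasDerivAt (fun t => ∫ s in (0:ℝ)..l, f t s) (∫ s in (0:ℝ)..l, G t s) t := by
  have h1 := hasDerivAt_int (l := l) hf t
  have : ∫ s in (0:ℝ)..l, G t s = ∫ s in (0:ℝ)..l, dT f t s := by
    have e : ∀ s, G t s = dT f t s - dS H t s := fun s => by rw [he]; ring
    simp only [e]
    rw [intervalIntegral.integral_sub ((hf.dT.cont t).intervalIntegrable _ _)
      ((hH.dS.cont t).intervalIntegrable _ _), integral_dS hH hp, sub_zero]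
  rw [this]; exact h1

/-- Two sided Gronwall -/
theorem gronwall {f f' : ℝ → ℝ} {K T : ℝ} 
    (hf : ∀ t, HasDerivAt f (f' t) t) (hb : ∀ t ∈ Icc (-T) T, |f' t| ≤ K * f t) :
    ∀ t ∈ Icc (-T) T, f t ≤ f 0 * Real.exp (K * |t|) := by
  have key : ∀ (g g' : ℝ → ℝ), (∀ t, HasDerivAt g (g' t) t) →
      (∀ t ∈ Icc (-T) T, g' t ≤ K * g t) → ∀ t ∈ Icc 0 T, g t ≤ g 0 * Real.exp (K * t) := by
    intro g g' hg hgb t ht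
    have hanti : AntitoneOn (fun t => g t * Real.exp (-(K * t))) (Icc 0 T) := by
      have hd : ∀ t, HasDerivAt (fun t => g t * Real.exp (-(K * t)))
          (g' t * Real.exp (-(K * t)) + g t * (Real.exp (-(K * t)) * (-(K * 1)))) t := fun t =>
        (hg t).mul (((hasDerivAt_id t).const_mul K).neg.exp)
      refine antitoneOn_of_deriv_nonpos (convex_Icc _ _) 
        (fun x _ => (hd x).continuousAt.continuousWithinAt)
        (fun x _ => (hd x).differentiableAt.differentiableWithinAt) ?_
      intro x hx
      rw [interior_Icc] at hx
      rw [(hd x).deriv]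
      have := hgb x ⟨by linarith [hx.1, hx.2], hx.2.le⟩
      nlinarith [Real.exp_pos (-(K * x))]
    have h0 := hanti ⟨le_refl 0, ht.1.trans ht.2⟩ ht ht.1
    simp only [mul_zero, neg_zero, Real.exp_zero, mul_one] at h0
    have h1 : Real.exp (-(K * t)) * Real.exp (K * t) = 1 := by
      rw [← Real.exp_add]; simp
    calc g t = (g t * Real.exp (-(K * t))) * Real.exp (K * t) := by rw [mul_assoc, h1, mul_one]
      _ ≤ _ := mul_le_mul_of_nonneg_right h0 (Real.exp_pos _).le
  intro t ht
  rcases le_total 0 t with h | h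
  · rw [abs_of_nonneg h]
    exact key f f' hf (fun t ht => (le_abs_self _).trans (hb t ht)) t ⟨h, ht.2⟩
  · rw [abs_of_nonpos h]
    have := key (fun t => f (-t)) (fun t => -f' (-t)) (fun t => by
      have := (hf (-t)).scomp t (hasDerivAt_neg t)
      rw [neg_one_smul] at this; exact this) (fun t ht => 
        (neg_le_abs _).trans (hb (-t) ⟨by linarith [ht.2], by linarith [ht.1]⟩)) (-t)
        ⟨by linarith, by linarith [ht.1]⟩
    simpa using this

/-- sup bound for a scalar function -/
theorem sup_bound {l : ℝ} (hl : 0 < l) {g g' b : ℝ → ℝ} (hg : ∀ s, HasDerivAt g (g' s) s)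
    (hc : Continuous g') (hbc : Continuous b)
    (hb : ∀ s ∈ Icc 0 l, |g' s| ≤ b s) {s : ℝ} (hs : s ∈ Icc 0 l) :
    g s ≤ 1 / l * (∫ x in (0:ℝ)..l, g x) + ∫ x in (0:ℝ)..l, b x := by
  have hgc : Continuous g := continuous_iff_continuousAt.2 fun x => (hg x).continuousAt
  set B := ∫ x in (0:ℝ)..l, b x
  have hb0 : ∀ x ∈ Icc 0 l, 0 ≤ b x := fun x hx => (abs_nonneg _).trans (hb x hx)
  have h1 : ∀ x ∈ Icc 0 l, ∀ y ∈ Icc 0 l, x ≤ y → |g y - g x| ≤ B := by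
    intro x hx y hy hxy
    rw [← intervalIntegral.integral_eq_sub_of_hasDerivAt (fun x _ => hg x)
      (hc.intervalIntegrable _ _)]
    calc _ ≤ ∫ z in x..y, |g' z| := intervalIntegral.abs_integral_le_integral_abs hxy
      _ ≤ ∫ z in x..y, b z := intervalIntegral.integral_mono_on hxy
          (hc.abs.intervalIntegrable _ _) (hbc.intervalIntegrable _ _)
          (fun z hz => hb z ⟨hx.1.trans hz.1, hz.2.trans hy.2⟩)
      _ ≤ B := by
        refine intervalIntegral.integral_mono_interval hx.1 hxy hy.2 ?_
          (hbc.intervalIntegrable _ _)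
        refine (MeasureTheory.ae_restrict_iff' measurableSet_Ioc).2 (Eventually.of_forall fun z hz => ?_)
        exact hb0 z ⟨hz.1.le, hz.2⟩
  have h2 : ∀ x ∈ Icc 0 l, g s ≤ g x + B := by
    intro x hx
    rcases le_total x s with h | h
    · linarith [le_abs_self (g s - g x), h1 x hx s hs h]
    · linarith [neg_abs_le (g x - g s), h1 s hs x hx h]
  have h3 : ∫ x in (0:ℝ)..l, g s ≤ ∫ x in (0:ℝ)..l, (g x + B) :=
    intervalIntegral.integral_mono_on hl.le (by simp)
      ((hgc.add continuous_const).intervalIntegrable _ _) h2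
  rw [intervalIntegral.integral_add (hgc.intervalIntegrable _ _) (by simp)] at h3
  simp only [intervalIntegral.integral_const, sub_zero, smul_eq_mul] at h3
  have : g s = 1 / l * (l * g s) := by field_simp
  rw [this]
  calc _ ≤ 1 / l * ((∫ x in (0:ℝ)..l, g x) + l * B) := by gcongr
    _ = _ := by field_simp

/-- Rolle-type bound for derivatives of periodic functions -/
theorem rolle_bound {l : ℝ} (hl : 0 < l) {f f' f'' b : ℝ → ℝ} (hf : ∀ s, HasDerivAt f (f' s) s)
    (hf' : ∀ s, HasDerivAt f' (f'' s) s) (hp : f l = f 0)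
    (hc : Continuous f'') (hbc : Continuous b)
    (hb : ∀ s ∈ Icc 0 l, |f'' s| ≤ b s) {s : ℝ} (hs : s ∈ Icc 0 l) :
    |f' s| ≤ ∫ x in (0:ℝ)..l, b x := by
  have hfc : Continuous f := continuous_iff_continuousAt.2 fun x => (hf x).continuousAt
  have hfc' : Continuous f' := continuous_iff_continuousAt.2 fun x => (hf' x).continuousAt
  have hz : ∫ x in (0:ℝ)..l, f' x = 0 := by
    rw [intervalIntegral.integral_eq_sub_of_hasDerivAt (fun x _ => hf x)
      (hfc'.intervalIntegrable _ _), hp, sub_self]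
  have h1 := sup_bound hl hf' hc hbc hb hs
  have h2 := sup_bound hl (g := fun s => - f' s) (fun s => (hf' s).neg) hc.neg hbc
    (fun s hs => by rw [abs_neg]; exact hb s hs) hs
  rw [intervalIntegral.integral_neg, hz] at h2
  rw [hz] at h1
  rw [abs_le]; constructor <;> linarith

end SM

namespace SM

/-- dot product in coordinates -/
def dt (a b : R3) : ℝ := a 0 * b 0 + a 1 * b 1 + a 2 * b 2

theorem cr0 (a b : R3) : (cross3 a b) 0 = a 1 * b 2 - a 2 * b 1 := rfl
theorem cr1 (a b : R3) : (cross3 a b) 1 = a 2 * b 0 - a 0 * b 2 := rfl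
theorem cr2 (a b : R3) : (cross3 a b) 2 = a 0 * b 1 - a 1 * b 0 := rfl

theorem ext3 {a b : R3} (h0 : a 0 = b 0) (h1 : a 1 = b 1) (h2 : a 2 = b 2) : a = b := by
  ext i; fin_cases i <;> assumption

theorem dt_inner (a b : R3) : dt a b = inner ℝ a b := by
  simp [dt, PiLp.inner_apply, Fin.sum_univ_three]; ring

theorem dt_self (a : R3) : dt a a = ‖a‖ ^ 2 := by
  rw [dt_inner, real_inner_self_eq_norm_sq]

theorem abs_dt_le (a b : R3) : |dt a b| ≤ ‖a‖ * ‖b‖ := by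
  rw [dt_inner]; exact abs_real_inner_le_norm a b

theorem dt_comm (a b : R3) : dt a b = dt b a := by simp only [dt]; ring

theorem norm_cr_sq (a b : R3) : ‖cross3 a b‖ ^ 2 = ‖a‖ ^ 2 * ‖b‖ ^ 2 - dt a b ^ 2 := by
  rw [← dt_self, ← dt_self, ← dt_self]; simp only [dt, cr0, cr1, cr2]; ring

theorem norm_cr_le (a b : R3) : ‖cross3 a b‖ ≤ ‖a‖ * ‖b‖ := by
  refine le_of_sq_le_sq ?_ (by positivity)
  rw [norm_cr_sq, mul_pow]; nlinarith [sq_nonneg (dt a b)]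

theorem abs_tr_le (a b c : R3) : |dt a (cross3 b c)| ≤ ‖a‖ * ‖b‖ * ‖c‖ := by
  refine (abs_dt_le _ _).trans ?_
  rw [mul_assoc]
  exact mul_le_mul_of_nonneg_left (norm_cr_le b c) (norm_nonneg a)

theorem hcoord {f : ℝ → R3} {f' : R3} {x : ℝ} (h : HasDerivAt f f' x) (i : Fin 3) :
    HasDerivAt (fun y => f y i) (f' i) x :=
  ((EuclideanSpace.proj i : R3 →L[ℝ] ℝ).hasFDerivAt).comp_hasDerivAt x h

theorem hcoord_iff {f : ℝ → R3} {f' : R3} {x : ℝ} 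
    (h : ∀ i, HasDerivAt (fun y => f y i) (f' i) x) : HasDerivAt f f' x := by
  have h1 : HasDerivAt (fun y => (fun i => f y i : Fin 3 → ℝ)) (fun i => f' i) x :=
    hasDerivAt_pi.2 h
  exact ((EuclideanSpace.equiv (Fin 3) ℝ).symm.toContinuousLinearMap.hasFDerivAt).comp_hasDerivAt x h1

theorem hdt {f g : ℝ → R3} {f' g' : R3} {x : ℝ} (hf : HasDerivAt f f' x)
    (hg : HasDerivAt g g' x) :
    HasDerivAt (fun y => dt (f y) (g y)) (dt f' (g x) + dt (f x) g') x := by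
  have := (((hcoord hf 0).mul (hcoord hg 0)).add ((hcoord hf 1).mul (hcoord hg 1))).add
    ((hcoord hf 2).mul (hcoord hg 2))
  exact this.congr_deriv (by simp only [dt]; ring)

theorem hcr {f g : ℝ → R3} {f' g' : R3} {x : ℝ} (hf : HasDerivAt f f' x)
    (hg : HasDerivAt g g' x) :
    HasDerivAt (fun y => cross3 (f y) (g y)) (cross3 f' (g x) + cross3 (f x) g') x := by
  refine hcoord_iff fun i => ?_
  fin_cases i
  · have := ((hcoord hf 1).mul (hcoord hg 2)).sub ((hcoord hf 2).mul (hcoord hg 1))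
    exact this.congr_deriv (by
      show _ = (cross3 f' (g x)) 0 + (cross3 (f x) g') 0
      simp only [cr0]; ring)
  · have := ((hcoord hf 2).mul (hcoord hg 0)).sub ((hcoord hf 0).mul (hcoord hg 2))
    exact this.congr_deriv (by
      show _ = (cross3 f' (g x)) 1 + (cross3 (f x) g') 1
      simp only [cr1]; ring)
  · have := ((hcoord hf 0).mul (hcoord hg 1)).sub ((hcoord hf 1).mul (hcoord hg 0))
    exact this.congr_deriv (by
      show _ = (cross3 f' (g x)) 2 + (cross3 (f x) g') 2
      simp only [cr2]; ring)

theorem Sm.coord {f : ℝ → ℝ → R3} (hf : Sm f) (i : Fin 3) : Sm (fun t s => f t s i) :=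
  contDiff_euclidean.1 hf i

theorem Sm.dt {f g : ℝ → ℝ → R3} (hf : Sm f) (hg : Sm g) :
    Sm (fun t s => dt (f t s) (g t s)) :=
  (((hf.coord 0).mul (hg.coord 0)).add ((hf.coord 1).mul (hg.coord 1))).add
    ((hf.coord 2).mul (hg.coord 2))

theorem Sm.cr {f g : ℝ → ℝ → R3} (hf : Sm f) (hg : Sm g) :
    Sm (fun t s => cross3 (f t s) (g t s)) := by
  refine contDiff_euclidean.2 fun i => ?_
  fin_cases i
  · exact ((hf.coord 1).mul (hg.coord 2)).sub ((hf.coord 2).mul (hg.coord 1))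
  · exact ((hf.coord 2).mul (hg.coord 0)).sub ((hf.coord 0).mul (hg.coord 2))
  · exact ((hf.coord 0).mul (hg.coord 1)).sub ((hf.coord 1).mul (hg.coord 0))

/-- the determinant expansion along a direction -/
theorem tr_expand (n a b c : R3) : dt n n * dt a (cross3 b c) =
    dt a n * dt n (cross3 b c) + dt b n * dt n (cross3 c a) + dt c n * dt n (cross3 a b) := by
  simp only [dt, cr0, cr1, cr2]; ring

/-- smooth periodic solution of the Schrödinger map equation -/
structure Sol (l : ℝ) (u : ℝ → ℝ → R3) : Prop where
  sm : Sm u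
  per : Per l u
  unit : ∀ t s, dt (u t s) (u t s) = 1
  eq : ∀ t s, dT u t s = cross3 (u t s) (dS (dS u) t s)

namespace Sol

theorem u_us {l : ℝ} {u : ℝ → ℝ → R3} (h : Sol l u) (t s : ℝ) : dt (u t s) (dS u t s) = 0 := by
  have h1 := hdt (h.sm.hS t s) (h.sm.hS t s)
  have h2 : (fun y => dt (u t y) (u t y)) = fun _ => 1 := funext fun y => h.unit t y
  rw [h2] at h1
  have := h1.unique (hasDerivAt_const s (1:ℝ))
  rw [dt_comm (dS u t s)] at this; linarith

theorem u_uss {l : ℝ} {u : ℝ → ℝ → R3} (h : Sol l u) (t s : ℝ) : dt (u t s) (dS (dS u) t s) = - dt (dS u t s) (dS u t s) := by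
  have h1 := hdt (h.sm.hS t s) (h.sm.dS.hS t s)
  have h2 : (fun y => dt (u t y) (dS u t y)) = fun _ => 0 := funext fun y => h.u_us t y
  rw [h2] at h1
  have := h1.unique (hasDerivAt_const s (0:ℝ))
  linarith

theorem u_p {l : ℝ} {u : ℝ → ℝ → R3} (h : Sol l u) (t s : ℝ) : dt (u t s) (dT u t s) = 0 := by
  rw [h.eq]; simp only [dt, cr0, cr1, cr2]; ring

theorem p_uss {l : ℝ} {u : ℝ → ℝ → R3} (h : Sol l u) (t s : ℝ) : dt (dT u t s) (dS (dS u) t s) = 0 := by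
  rw [h.eq]; simp only [dt, cr0, cr1, cr2]; ring

theorem u_ps {l : ℝ} {u : ℝ → ℝ → R3} (h : Sol l u) (t s : ℝ) : dt (u t s) (dS (dT u) t s) = - dt (dT u t s) (dS u t s) := by
  have h1 := hdt (h.sm.hS t s) (h.sm.dT.hS t s)
  have h2 : (fun y => dt (u t y) (dT u t y)) = fun _ => 0 := funext fun y => h.u_p t y
  rw [h2] at h1
  have := h1.unique (hasDerivAt_const s (0:ℝ))
  rw [dt_comm (dS u t s)] at this; linarith

theorem u_pss {l : ℝ} {u : ℝ → ℝ → R3} (h : Sol l u) (t s : ℝ) : dt (u t s) (dS (dS (dT u)) t s) = - 2 * dt (dS (dT u) t s) (dS u t s) := by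
  have h1 := hdt (h.sm.hS t s) (h.sm.dT.dS.hS t s)
  have h2 : (fun y => dt (u t y) (dS (dT u) t y)) = fun y => - dt (dT u t y) (dS u t y) :=
    funext fun y => h.u_ps t y
  rw [h2] at h1
  have := h1.unique (hdt (h.sm.dT.hS t s) (h.sm.dS.hS t s)).neg
  rw [dt_comm (dS u t s), h.p_uss] at this; linarith

theorem us_t {l : ℝ} {u : ℝ → ℝ → R3} (h : Sol l u) : dT (dS u) = dS (dT u) := h.sm.comm
theorem uss_t {l : ℝ} {u : ℝ → ℝ → R3} (h : Sol l u) : dT (dS (dS u)) = dS (dS (dT u)) := by rw [h.sm.dS.comm, h.sm.comm]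
theorem ps_t {l : ℝ} {u : ℝ → ℝ → R3} (h : Sol l u) : dT (dS (dT u)) = dS (dT (dT u)) := h.sm.dT.comm

theorem p_t {l : ℝ} {u : ℝ → ℝ → R3} (h : Sol l u) (t s : ℝ) : dT (dT u) t s = cross3 (dT u t s) (dS (dS u) t s) +
    cross3 (u t s) (dS (dS (dT u)) t s) := by
  have h1 := hcr (h.sm.hT t s) (h.sm.dS.dS.hT t s)
  have h2 : (fun y => cross3 (u y s) (dS (dS u) y s)) = fun y => dT u y s :=
    funext fun y => (h.eq y s).symm
  rw [h2, h.uss_t] at h1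
  exact (h.sm.dT.hT t s).unique h1

theorem p_s {l : ℝ} {u : ℝ → ℝ → R3} (h : Sol l u) (t s : ℝ) : dS (dT u) t s = cross3 (dS u t s) (dS (dS u) t s) +
    cross3 (u t s) (dS (dS (dS u)) t s) := by
  have h1 := hcr (h.sm.hS t s) (h.sm.dS.dS.hS t s)
  have h2 : (fun y => cross3 (u t y) (dS (dS u) t y)) = fun y => dT u t y :=
    funext fun y => (h.eq t y).symm
  rw [h2] at h1
  exact (h.sm.dT.hS t s).unique h1

/-- `|u_ss|² = |p|² + |u_s|⁴` -/
theorem uss_sq {l : ℝ} {u : ℝ → ℝ → R3} (h : Sol l u) (t s : ℝ) : dt (dS (dS u) t s) (dS (dS u) t s) = dt (dT u t s) (dT u t s)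
    + dt (dS u t s) (dS u t s) ^ 2 := by
  have h1 := norm_cr_sq (u t s) (dS (dS u) t s)
  rw [← h.eq, ← dt_self, ← dt_self, ← dt_self, h.unit, h.u_uss] at h1
  linarith

/-- third derivative -/
theorem usss_u {l : ℝ} {u : ℝ → ℝ → R3} (h : Sol l u) (t s : ℝ) : dt (u t s) (dS (dS (dS u)) t s) = - 3 * dt (dS u t s) (dS (dS u) t s) := by
  have h1 := hdt (h.sm.hS t s) (h.sm.dS.dS.hS t s)
  have h2 : (fun y => dt (u t y) (dS (dS u) t y)) = fun y => - dt (dS u t y) (dS u t y) :=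
    funext fun y => h.u_uss t y
  rw [h2] at h1
  have := h1.unique (hdt (h.sm.dS.hS t s) (h.sm.dS.hS t s)).neg
  rw [dt_comm (dS (dS u) t s)] at this; linarith

/-- the key determinant identity behind the second conservation law -/
theorem det_key {l : ℝ} {u : ℝ → ℝ → R3} (h : Sol l u) (t s : ℝ) : dt (dT u t s) (cross3 (dS u t s) (dS (dT u) t s)) =
    dt (dS u t s) (dS (dS u) t s) * dt (dS u t s) (dT u t s) := by
  have h1 := tr_expand (u t s) (dT u t s) (dS u t s) (dS (dT u) t s)
  rw [dt_comm (dT u t s) (u t s), dt_comm (dS u t s) (u t s), dt_comm (dS (dT u) t s) (u t s),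
    h.unit, h.u_p, h.u_us, h.u_ps] at h1
  have h2 : dt (u t s) (cross3 (dT u t s) (dS u t s)) = - dt (dS u t s) (dS (dS u) t s) := by
    have e : dt (u t s) (cross3 (dT u t s) (dS u t s)) =
        dt (u t s) (dS (dS u) t s) * dt (u t s) (dS u t s)
        - dt (u t s) (u t s) * dt (dS u t s) (dS (dS u) t s) := by
      rw [h.eq]; simp only [dt, cr0, cr1, cr2]; ring
    rw [e, h.unit, h.u_us]; ring
  rw [h2] at h1
  rw [dt_comm (dS u t s) (dT u t s)]; linarith

/-- first conservation law -/
theorem E1 {l : ℝ} {u : ℝ → ℝ → R3} (h : Sol l u) (t : ℝ) : (∫ s in (0:ℝ)..l, dt (dS u t s) (dS u t s)) =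
    ∫ s in (0:ℝ)..l, dt (dS u 0 s) (dS u 0 s) := by
  have key := energy (l := l) (f := fun t s => dt (dS u t s) (dS u t s)) (G := fun _ _ => 0)
    (H := fun t s => 2 * dt (dS u t s) (dT u t s)) (h.sm.dS.dt h.sm.dS)
    ((Sm.const 2).mul (h.sm.dS.dt h.sm.dT))
    (by intro t s; simp only [h.per.dS t s, h.per.dT t s]) (by
      intro t s
      have a1 := (hdt (h.sm.dS.hT t s) (h.sm.dS.hT t s)).deriv
      have a2 := ((hdt (h.sm.dS.hS t s) (h.sm.dT.hS t s)).const_mul 2).deriv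
      have b1 := h.p_uss t s
      have b2 := congrFun (congrFun h.us_t t) s
      show deriv _ t = 0 + deriv _ s
      rw [a1, a2, b2, dt_comm (dS (dS u) t s), b1, dt_comm (dS (dT u) t s)]
      ring)
  refine is_const_of_deriv_eq_zero (f := fun t => ∫ s in (0:ℝ)..l, dt (dS u t s) (dS u t s))
    (fun t => (key t).differentiableAt) (fun t => ?_) t 0
  rw [(key t).deriv]; simp

/-- second conservation law -/
theorem E2 {l : ℝ} {u : ℝ → ℝ → R3} (h : Sol l u) (t : ℝ) : (∫ s in (0:ℝ)..l, (dt (dT u t s) (dT u t s)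
      - 1 / 4 * (dt (dS u t s) (dS u t s) * dt (dS u t s) (dS u t s)))) =
    ∫ s in (0:ℝ)..l, (dt (dT u 0 s) (dT u 0 s)
      - 1 / 4 * (dt (dS u 0 s) (dS u 0 s) * dt (dS u 0 s) (dS u 0 s))) := by
  have n1 := h.sm.dS.dt h.sm.dS
  have key := energy (l := l) (f := fun t s => dt (dT u t s) (dT u t s)
      - 1 / 4 * (dt (dS u t s) (dS u t s) * dt (dS u t s) (dS u t s))) (G := fun _ _ => 0)
    (H := fun t s => 2 * dt (dT u t s) (cross3 (u t s) (dS (dT u) t s)) -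
      dt (dS u t s) (dS u t s) * dt (dS u t s) (dT u t s))
    ((h.sm.dT.dt h.sm.dT).sub ((Sm.const _).mul (n1.mul n1)))
    (((Sm.const 2).mul (h.sm.dT.dt (h.sm.cr h.sm.dT.dS))).sub (n1.mul (h.sm.dS.dt h.sm.dT)))
    (by intro t s; simp only [h.per t s, h.per.dS t s, h.per.dT t s, h.per.dT.dS t s]) (by
      intro t s
      have c1 := hdt (h.sm.dS.hT t s) (h.sm.dS.hT t s)
      have a1 := ((hdt (h.sm.dT.hT t s) (h.sm.dT.hT t s)).sub ((c1.mul c1).const_mul (1/4))).deriv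
      have a2 := (((hdt (h.sm.dT.hS t s) (hcr (h.sm.hS t s) (h.sm.dT.dS.hS t s))).const_mul 2).sub
        ((hdt (h.sm.dS.hS t s) (h.sm.dS.hS t s)).mul
          (hdt (h.sm.dS.hS t s) (h.sm.dT.hS t s)))).deriv
      have b1 := h.p_uss t s
      have b2 := congrFun (congrFun h.us_t t) s
      have b3 := h.det_key t s
      have b4 := h.p_t t s
      show deriv _ t = 0 + deriv _ s
      refine a1.trans (Eq.trans ?_ (congrArg (fun x => 0 + x) a2.symm))
      simp only [b2, b4]
      simp only [dt, cr0, cr1, cr2, PiLp.add_apply] at b1 b3 ⊢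
      linear_combination (-2) * b3 + 
        ((dS u t s 0 * dS u t s 0 + dS u t s 1 * dS u t s 1 + dS u t s 2 * dS u t s 2)) * b1)
  refine is_const_of_deriv_eq_zero (f := fun t => ∫ s in (0:ℝ)..l, (dt (dT u t s) (dT u t s)
      - 1 / 4 * (dt (dS u t s) (dS u t s) * dt (dS u t s) (dS u t s))))
    (fun t => (key t).differentiableAt) (fun t => ?_) t 0
  rw [(key t).deriv]; simp

theorem pxuss {l : ℝ} {u : ℝ → ℝ → R3} (h : Sol l u) (t s : ℝ) : cross3 (dT u t s) (dS (dS u) t s) = 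
    dt (dS u t s) (dS u t s) • cross3 (u t s) (dT u t s) - dt (dT u t s) (dT u t s) • u t s := by
  have b1 := h.u_uss t s
  have b2 := h.u_p t s
  have b3 := h.unit t s
  have b4 := h.p_uss t s
  have e : dS (dS u) t s = - dt (dS u t s) (dS u t s) • u t s - cross3 (u t s) (dT u t s) := by
    have : cross3 (u t s) (dT u t s) = dt (u t s) (dS (dS u) t s) • u t s
        - dt (u t s) (u t s) • dS (dS u) t s := by
      rw [h.eq]
      refine ext3 ?_ ?_ ?_ <;> simp [dt, cr0, cr1, cr2] <;> ring
    rw [this, b1, b3]; module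
  rw [e]
  have : ∀ (c : ℝ) (a p : R3), cross3 p (-c • a - cross3 a p) = c • cross3 a p
      - (dt p p • a - dt a p • p) := by
    intro c a p
    refine ext3 ?_ ?_ ?_ <;> simp [dt, cr0, cr1, cr2] <;> ring
  rw [this, b2, zero_smul, sub_zero]

/-- energy identity for `∫ |p_s|²` -/
theorem E3 {l : ℝ} {u : ℝ → ℝ → R3} (h : Sol l u) (t : ℝ) : HasDerivAt (fun t => ∫ s in (0:ℝ)..l, dt (dS (dT u) t s) (dS (dT u) t s))
    (∫ s in (0:ℝ)..l, (4 * (dt (dS u t s) (dS (dS u) t s) *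
        dt (dS (dT u) t s) (cross3 (u t s) (dT u t s)))
      + 2 * (dt (dS u t s) (dS u t s) * dt (dS (dT u) t s) (cross3 (dS u t s) (dT u t s)))
      - 4 * (dt (dT u t s) (dT u t s) * dt (dS (dT u) t s) (dS u t s)))) t := by
  have n1 := h.sm.dS.dt h.sm.dS
  refine energy (l := l) (f := fun t s => dt (dS (dT u) t s) (dS (dT u) t s))
    (G := fun t s => (4 * (dt (dS u t s) (dS (dS u) t s) *
        dt (dS (dT u) t s) (cross3 (u t s) (dT u t s)))
      + 2 * (dt (dS u t s) (dS u t s) * dt (dS (dT u) t s) (cross3 (dS u t s) (dT u t s)))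
      - 4 * (dt (dT u t s) (dT u t s) * dt (dS (dT u) t s) (dS u t s))))
    (H := fun t s => 2 * dt (dS (dT u) t s) (dT (dT u) t s) -
      2 * (dt (dS u t s) (dS u t s) * dt (dS (dT u) t s) (cross3 (u t s) (dT u t s))))
    (h.sm.dT.dS.dt h.sm.dT.dS)
    (((Sm.const 2).mul (h.sm.dT.dS.dt h.sm.dT.dT)).sub ((Sm.const 2).mul
      (n1.mul (h.sm.dT.dS.dt (h.sm.cr h.sm.dT)))))
    (by intro t s; simp only [h.per t s, h.per.dS t s, h.per.dT t s, h.per.dT.dS t s,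
      h.per.dT.dT t s]) ?_ t
  intro t s
  have a1 := (hdt (h.sm.dT.dS.hT t s) (h.sm.dT.dS.hT t s)).deriv
  have a2 := (((hdt (h.sm.dT.dS.hS t s) (h.sm.dT.dT.hS t s)).const_mul 2).sub
    (((hdt (h.sm.dS.hS t s) (h.sm.dS.hS t s)).mul (hdt (h.sm.dT.dS.hS t s)
      (hcr (h.sm.hS t s) (h.sm.dT.hS t s)))).const_mul 2)).deriv
  have b2 := congrFun (congrFun h.ps_t t) s
  have b3 := h.u_pss t s
  have b4 := h.p_t t s
  rw [h.pxuss] at b4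
  refine a1.trans (Eq.trans ?_ (congrArg (fun x => _ + x) a2.symm))
  simp only [b2, b4]
  simp only [dt, cr0, cr1, cr2, PiLp.add_apply, PiLp.sub_apply, PiLp.smul_apply, smul_eq_mul]
    at b3 ⊢
  linear_combination (2 * (dT u t s 0 * dT u t s 0 + dT u t s 1 * dT u t s 1
    + dT u t s 2 * dT u t s 2)) * b3

end Sol

end SM

namespace SM

/-- `H¹` energy identity for the difference -/
theorem D1 {l : ℝ} {u v : ℝ → ℝ → R3} (hu : Sol l u) (hv : Sol l v) (t : ℝ) :
    HasDerivAt (fun t => ∫ s in (0:ℝ)..l, (dt (u t s - v t s) (u t s - v t s)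
      + dt (dS u t s - dS v t s) (dS u t s - dS v t s)))
    (∫ s in (0:ℝ)..l, (2 * dt (dS u t s - dS v t s) (cross3 (u t s - v t s) (dS (dS (dS v)) t s))
      - 2 * dt (u t s - v t s) (cross3 (dS u t s) (dS u t s - dS v t s)))) t := by
  have w0 := hu.sm.sub hv.sm
  have w1 := hu.sm.dS.sub hv.sm.dS
  have z0 := hu.sm.dT.sub hv.sm.dT
  refine energy (l := l) (f := fun t s => (dt (u t s - v t s) (u t s - v t s)
      + dt (dS u t s - dS v t s) (dS u t s - dS v t s)))
    (G := fun t s => (2 * dt (dS u t s - dS v t s) (cross3 (u t s - v t s) (dS (dS (dS v)) t s))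
      - 2 * dt (u t s - v t s) (cross3 (dS u t s) (dS u t s - dS v t s))))
    (H := fun t s => 2 * dt (u t s - v t s) (cross3 (u t s) (dS u t s - dS v t s)) +
      2 * dt (dS u t s - dS v t s) (dT u t s - dT v t s) -
      2 * dt (dS u t s - dS v t s) (cross3 (u t s - v t s) (dS (dS v) t s)))
    ((w0.dt w0).add (w1.dt w1))
    ((((Sm.const 2).mul (w0.dt (hu.sm.cr w1))).add ((Sm.const 2).mul (w1.dt z0))).sub
      ((Sm.const 2).mul (w1.dt (w0.cr hv.sm.dS.dS))))
    (by intro t s; simp only [hu.per t s, hu.per.dS t s, hu.per.dT t s,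
      hv.per t s, hv.per.dS t s, hv.per.dT t s, hv.per.dS.dS t s]) ?_ t
  intro t s
  have tw0 := (hu.sm.hT t s).sub (hv.sm.hT t s)
  have tw1 := (hu.sm.dS.hT t s).sub (hv.sm.dS.hT t s)
  have sw0 := (hu.sm.hS t s).sub (hv.sm.hS t s)
  have sw1 := (hu.sm.dS.hS t s).sub (hv.sm.dS.hS t s)
  have sz0 := (hu.sm.dT.hS t s).sub (hv.sm.dT.hS t s)
  have a1 := ((hdt tw0 tw0).add (hdt tw1 tw1)).deriv
  have a2 := ((((hdt sw0 (hcr (hu.sm.hS t s) sw1)).const_mul 2).add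
    ((hdt sw1 sz0).const_mul 2)).sub
      ((hdt sw1 (hcr sw0 (hv.sm.dS.dS.hS t s))).const_mul 2)).deriv
  have b1 := congrFun (congrFun hu.us_t t) s
  have b2 := congrFun (congrFun hv.us_t t) s
  refine a1.trans (Eq.trans ?_ (congrArg (fun x => _ + x) a2.symm))
  simp only [b1, b2, hu.eq t s, hv.eq t s, Pi.sub_apply]
  simp only [dt, cr0, cr1, cr2, PiLp.add_apply, PiLp.sub_apply]
  ring

/-- the algebraic heart of the second order estimate -/
theorem algA (u v us vs p q ps qs : R3)
    (hv1 : dt v v = 1) (hvq : dt v q = 0) (hvs : dt v vs = 0) (hvqs : dt v qs = - dt q vs) 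
    (hup : dt u p = 0) :
    dt (ps - qs) (cross3 u ps - cross3 v qs) + dt (p - q) (cross3 us ps - cross3 vs qs)
    = dt v (ps - qs) * dt v (cross3 (u - v) qs) + dt v (u - v) * dt v (cross3 qs ps)
      - dt q vs * dt v (cross3 (ps - qs) (u - v)) + dt (p - q) (cross3 (us - vs) ps)
      - dt p (u - v) * dt v (cross3 vs (ps - qs)) + dt v (ps - qs) * dt v (cross3 (p - q) vs) := by
  have h1 := tr_expand v (ps - qs) (u - v) qs
  have h2 := tr_expand v (p - q) vs (ps - qs)
  have e1 : dt (p - q) v = - dt p (u - v) := by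
    have : dt (p - q) v = - dt p (u - v) + dt u p - dt v q := by
      simp only [dt, PiLp.sub_apply]; ring
    rw [this, hup, hvq]; ring
  rw [e1, hv1, dt_comm vs v, hvs, dt_comm (ps - qs) v] at h2
  rw [hv1, dt_comm (u - v) v, dt_comm (ps - qs) v, dt_comm qs v, hvqs] at h1
  have e2 : dt (ps - qs) (cross3 u ps - cross3 v qs) = dt (ps - qs) (cross3 (u - v) qs) := by
    simp only [dt, cr0, cr1, cr2, PiLp.sub_apply]; ring
  have e3 : dt (p - q) (cross3 us ps - cross3 vs qs) = dt (p - q) (cross3 (us - vs) ps) +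
      dt (p - q) (cross3 vs (ps - qs)) := by
    simp only [dt, cr0, cr1, cr2, PiLp.sub_apply]; ring
  have e4 : dt v (cross3 qs (ps - qs)) = dt v (cross3 qs ps) := by
    simp only [dt, cr0, cr1, cr2, PiLp.sub_apply]; ring
  rw [e4] at h1
  rw [e2, e3]
  linear_combination h1 + h2

/-- right side of the second order energy identity -/
def G2 (u v us vs uss vss p q ps qs : R3) : ℝ :=
  2 * dt (p - q) (cross3 p uss - cross3 q vss)
  - 2 * (dt v (ps - qs) * dt v (cross3 (u - v) qs) + dt v (u - v) * dt v (cross3 qs ps)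
    + (dt qs vs + dt q vss) * dt v (cross3 (p - q) (u - v))
    + dt q vs * dt vs (cross3 (p - q) (u - v))
    + dt q vs * dt v (cross3 (p - q) (us - vs))
    + dt (p - q) (cross3 (us - vs) ps)
    + (dt ps (u - v) + dt p (us - vs)) * dt v (cross3 vs (p - q))
    + dt p (u - v) * dt v (cross3 vss (p - q))
    + dt v (ps - qs) * dt v (cross3 (p - q) vs))

set_option maxRecDepth 10000 in
theorem D2 {l : ℝ} {u v : ℝ → ℝ → R3} (hu : Sol l u) (hv : Sol l v) (t : ℝ) :
    HasDerivAt (fun t => ∫ s in (0:ℝ)..l, dt (dT u t s - dT v t s) (dT u t s - dT v t s))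
    (∫ s in (0:ℝ)..l, G2 (u t s) (v t s) (dS u t s) (dS v t s) (dS (dS u) t s) (dS (dS v) t s)
      (dT u t s) (dT v t s) (dS (dT u) t s) (dS (dT v) t s)) t := by
  have w0 := hu.sm.sub hv.sm
  have z0 := hu.sm.dT.sub hv.sm.dT
  refine energy (l := l) (f := fun t s => dt (dT u t s - dT v t s) (dT u t s - dT v t s))
    (G := fun t s => G2 (u t s) (v t s) (dS u t s) (dS v t s) (dS (dS u) t s) (dS (dS v) t s)
      (dT u t s) (dT v t s) (dS (dT u) t s) (dS (dT v) t s))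
    (H := fun t s => 2 * dt (dT u t s - dT v t s)
        (cross3 (u t s) (dS (dT u) t s) - cross3 (v t s) (dS (dT v) t s)) +
      2 * (dt (dT v t s) (dS v t s) * dt (v t s) (cross3 (dT u t s - dT v t s) (u t s - v t s))) +
      2 * (dt (dT u t s) (u t s - v t s) * dt (v t s) (cross3 (dS v t s) (dT u t s - dT v t s))))
    (z0.dt z0)
    ((((Sm.const 2).mul (z0.dt ((hu.sm.cr hu.sm.dT.dS).sub (hv.sm.cr hv.sm.dT.dS)))).add 
      ((Sm.const 2).mul ((hv.sm.dT.dt hv.sm.dS).mul (hv.sm.dt (z0.cr w0))))).add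
      ((Sm.const 2).mul ((hu.sm.dT.dt w0).mul (hv.sm.dt (hv.sm.dS.cr z0)))))
    (by intro t s; simp only [hu.per t s, hu.per.dS t s, hu.per.dT t s, hu.per.dT.dS t s,
      hv.per t s, hv.per.dS t s, hv.per.dT t s, hv.per.dT.dS t s]) ?_ t
  intro t s
  have tz0 := (hu.sm.dT.hT t s).sub (hv.sm.dT.hT t s)
  have sw0 := (hu.sm.hS t s).sub (hv.sm.hS t s)
  have sz0 := (hu.sm.dT.hS t s).sub (hv.sm.dT.hS t s)
  have a1 := (hdt tz0 tz0).deriv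
  have a2 := ((((hdt sz0 ((hcr (hu.sm.hS t s) (hu.sm.dT.dS.hS t s)).sub
      (hcr (hv.sm.hS t s) (hv.sm.dT.dS.hS t s)))).const_mul 2).add
    (((hdt (hv.sm.dT.hS t s) (hv.sm.dS.hS t s)).mul
      (hdt (hv.sm.hS t s) (hcr sz0 sw0))).const_mul 2)).add
    (((hdt (hu.sm.dT.hS t s) sw0).mul
      (hdt (hv.sm.hS t s) (hcr (hv.sm.dS.hS t s) sz0))).const_mul 2)).deriv
  have k := algA (u t s) (v t s) (dS u t s) (dS v t s) (dT u t s) (dT v t s) (dS (dT u) t s)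
    (dS (dT v) t s) (hv.unit t s) (hv.u_p t s) (hv.u_us t s) (hv.u_ps t s) (hu.u_p t s)
  refine a1.trans (Eq.trans ?_ (congrArg (fun x => _ + x) a2.symm))
  simp only [hu.p_t t s, hv.p_t t s, Pi.sub_apply]
  generalize u t s = u0 at *
  generalize v t s = v0 at *
  generalize dS u t s = u1 at *
  generalize dS v t s = v1 at *
  generalize dS (dS u) t s = u2 at *
  generalize dS (dS v) t s = v2 at *
  generalize dT u t s = p0 at *
  generalize dT v t s = q0 at *
  generalize dS (dT u) t s = p1 at *
  generalize dS (dT v) t s = q1 at *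
  generalize dS (dS (dT u)) t s = p2 at *
  generalize dS (dS (dT v)) t s = q2 at *
  clear a1 a2
  simp only [G2]
  simp only [dt, cr0, cr1, cr2, PiLp.add_apply, PiLp.sub_apply] at k ⊢
  linear_combination (-2) * k

/-- normal component of `z_s` -/
theorem v_zs {l : ℝ} {u v : ℝ → ℝ → R3} (hu : Sol l u) (hv : Sol l v) (t s : ℝ) :
    dt (v t s) (dS (dT u) t s - dS (dT v) t s) = - dt (dS (dT u) t s) (u t s - v t s)
      - dt (dT u t s) (dS u t s - dS v t s) - dt (dT u t s - dT v t s) (dS v t s) := by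
  have h1 := hu.u_ps t s
  have h2 := hv.u_ps t s
  simp only [dt, PiLp.sub_apply] at h1 h2 ⊢
  linear_combination h1 - h2

theorem v_w {u v : R3} (hu : dt u u = 1) (hv : dt v v = 1) :
    dt v (u - v) = - (1 / 2) * dt (u - v) (u - v) := by
  simp only [dt, PiLp.sub_apply] at hu hv ⊢
  linear_combination (1 / 2) * hu - (1 / 2) * hv

theorem z_eq {l : ℝ} {u v : ℝ → ℝ → R3} (hu : Sol l u) (hv : Sol l v) (t s : ℝ) :
    dT u t s - dT v t s = cross3 (u t s) (dS (dS u) t s - dS (dS v) t s)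
      + cross3 (u t s - v t s) (dS (dS v) t s) := by
  rw [hu.eq, hv.eq]
  refine ext3 ?_ ?_ ?_ <;> simp [cr0, cr1, cr2] <;> ring

theorem u_wss {l : ℝ} {u v : ℝ → ℝ → R3} (hu : Sol l u) (hv : Sol l v) (t s : ℝ) :
    dt (u t s) (dS (dS u) t s - dS (dS v) t s) =
      - dt (dS u t s - dS v t s) (dS u t s + dS v t s) - dt (u t s - v t s) (dS (dS v) t s) := by
  have h1 := hu.u_uss t s
  have h2 := hv.u_uss t s
  simp only [dt, PiLp.sub_apply, PiLp.add_apply] at h1 h2 ⊢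
  linear_combination h1 - h2

end SM

namespace SM

theorem lin3 {l : ℝ} (hl : 0 < l) {f g1 g2 g3 : ℝ → ℝ} (c0 c1 c2 c3 : ℝ) (h1 : Continuous g1)
    (h2 : Continuous g2) (h3 : Continuous g3)
    (hb : ∀ s ∈ Icc 0 l, |f s| ≤ c0 + c1 * g1 s + c2 * g2 s + c3 * g3 s) :
    |∫ s in (0:ℝ)..l, f s| ≤ c0 * l + c1 * (∫ s in (0:ℝ)..l, g1 s) + c2 * (∫ s in (0:ℝ)..l, g2 s)
      + c3 * (∫ s in (0:ℝ)..l, g3 s) := by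
  have hc1 := h1.const_mul c1
  have hc2 := h2.const_mul c2
  have hc3 := h3.const_mul c3
  have hc0 : Continuous (fun _ : ℝ => c0) := continuous_const
  have e : ∫ s in (0:ℝ)..l, (c0 + c1 * g1 s + c2 * g2 s + c3 * g3 s) = 
      c0 * l + c1 * (∫ s in (0:ℝ)..l, g1 s) + c2 * (∫ s in (0:ℝ)..l, g2 s)
      + c3 * (∫ s in (0:ℝ)..l, g3 s) := by
    have hd1 : Continuous (fun s => c0 + c1 * g1 s) := hc0.add hc1
    have hd2 : Continuous (fun s => c0 + c1 * g1 s + c2 * g2 s) := hd1.add hc2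
    rw [intervalIntegral.integral_add (hd2.intervalIntegrable _ _)
      (hc3.intervalIntegrable _ _),
      intervalIntegral.integral_add (hd1.intervalIntegrable _ _)
      (hc2.intervalIntegrable _ _),
      intervalIntegral.integral_add (hc0.intervalIntegrable _ _)
      (hc1.intervalIntegrable _ _)]
    simp only [intervalIntegral.integral_const_mul, intervalIntegral.integral_const, smul_eq_mul]
    ring
  rw [← e, ← Real.norm_eq_abs]
  refine intervalIntegral.norm_integral_le_of_norm_le hl.le 
    (Eventually.of_forall fun s hs => ?_) ((((hc0.add hc1).add hc2).add hc3).intervalIntegrable _ _)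
  rw [Real.norm_eq_abs]
  exact hb s ⟨hs.1.le, hs.2⟩

theorem Sm.cdt {f : ℝ → ℝ → R3} (h : Sm f) (t : ℝ) :
    Continuous (fun s => SM.dt (f t s) (f t s)) := (h.dt h).cont t

theorem dt_nonneg (a : R3) : 0 ≤ dt a a := by rw [dt_self]; positivity

theorem int_dt_nonneg {l : ℝ} (hl : 0 < l) (f : ℝ → R3) :
    0 ≤ ∫ s in (0:ℝ)..l, dt (f s) (f s) :=
  intervalIntegral.integral_nonneg hl.le fun _ _ => dt_nonneg _

/-- one dimensional Sobolev embedding -/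
theorem vsup {l : ℝ} (hl : 0 < l) {f : ℝ → ℝ → R3} (h : Sm f) (t : ℝ) {s : ℝ} (hs : s ∈ Icc 0 l) :
    dt (f t s) (f t s) ≤ (1 / l + 1) * ((∫ x in (0:ℝ)..l, dt (f t x) (f t x)) +
      ∫ x in (0:ℝ)..l, dt (dS f t x) (dS f t x)) := by
  have h1 := sup_bound hl (g := fun s => dt (f t s) (f t s))
    (b := fun s => dt (f t s) (f t s) + dt (dS f t s) (dS f t s))
    (fun s => hdt (h.hS t s) (h.hS t s))
    (((h.dS.dt h).cont t).add ((h.dt h.dS).cont t))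
    ((h.cdt t).add (h.dS.cdt t)) (fun s _ => by
      rw [dt_comm (dS f t s) (f t s), ← two_mul, abs_mul, abs_two, dt_self, dt_self]
      nlinarith [abs_dt_le (f t s) (dS f t s), sq_nonneg (‖f t s‖ - ‖dS f t s‖)]) hs
  rw [intervalIntegral.integral_add ((h.cdt t).intervalIntegrable _ _)
    ((h.dS.cdt t).intervalIntegrable _ _)] at h1
  have h2 := int_dt_nonneg hl (dS f t)
  have : 0 < 1 / l := by positivity
  nlinarith [mul_nonneg this.le h2]

theorem Sol.us_uss_le {l : ℝ} {u : ℝ → ℝ → R3} (h : Sol l u) (t s : ℝ) :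
    |dt (dS u t s) (dS (dS u) t s)| ≤ ‖dT u t s‖ * ‖dS u t s‖ := by
  have h2 : dt (u t s) (cross3 (dT u t s) (dS u t s)) = - dt (dS u t s) (dS (dS u) t s) := by
    have e : dt (u t s) (cross3 (dT u t s) (dS u t s)) =
        dt (u t s) (dS (dS u) t s) * dt (u t s) (dS u t s)
        - dt (u t s) (u t s) * dt (dS u t s) (dS (dS u) t s) := by
      rw [h.eq]; simp only [dt, cr0, cr1, cr2]; ring
    rw [e, h.unit, h.u_us]; ring
  have h3 := abs_tr_le (u t s) (dT u t s) (dS u t s)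
  have h4 : ‖u t s‖ = 1 := by
    have := h.unit t s
    rw [dt_self] at this
    nlinarith [norm_nonneg (u t s)]
  rw [h2, abs_neg, h4, one_mul] at h3
  exact h3

theorem Sol.norm_u {l : ℝ} {u : ℝ → ℝ → R3} (h : Sol l u) (t s : ℝ) : ‖u t s‖ = 1 := by
  have := h.unit t s
  rw [dt_self] at this
  nlinarith [norm_nonneg (u t s)]

theorem dt_le_of_coord {a : R3} {A : ℝ} (h : ∀ i, |a i| ≤ A) : dt a a ≤ 3 * A ^ 2 := by
  have h0 := sq_le_sq' (abs_le.1 (h 0)).1 (abs_le.1 (h 0)).2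
  have h1 := sq_le_sq' (abs_le.1 (h 1)).1 (abs_le.1 (h 1)).2
  have h2 := sq_le_sq' (abs_le.1 (h 2)).1 (abs_le.1 (h 2)).2
  simp only [dt]; nlinarith

theorem coord_abs_le (a : R3) (i : Fin 3) : |a i| ≤ 1 + dt a a := by
  have : (a i) ^ 2 ≤ dt a a := by
    simp only [dt]
    fin_cases i <;> simp <;> nlinarith [sq_nonneg (a 0), sq_nonneg (a 1), sq_nonneg (a 2)]
  rw [abs_le]; constructor <;> nlinarith [sq_nonneg (a i - 1), sq_nonneg (a i + 1)]

theorem Per.lz {l : ℝ} {u : ℝ → ℝ → R3} (h : Per l u) (t : ℝ) (i : Fin 3) : 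
    u t l i = u t 0 i := by
  have := h t 0
  rw [zero_add] at this; rw [this]

/-- pointwise bounds on the initial data -/
theorem Sol.init {l M : ℝ} (hl : 0 < l) {u : ℝ → ℝ → R3} (h : Sol l u)
    (hM : ∫ s in (0:ℝ)..l, dt (dS (dS (dS u)) 0 s) (dS (dS (dS u)) 0 s) ≤ M) {s : ℝ}
    (hs : s ∈ Icc 0 l) : dt (dS (dS u) 0 s) (dS (dS u) 0 s) ≤ 3 * (l + M) ^ 2 ∧
      dt (dS u 0 s) (dS u 0 s) ≤ 3 * (l * (l + M)) ^ 2 := by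
  have h2 : ∀ i : Fin 3, ∀ s ∈ Icc 0 l, |dS (dS u) 0 s i| ≤ l + M := by
    intro i s hs
    have := rolle_bound hl (f := fun s => dS u 0 s i)
      (b := fun s => 1 + dt (dS (dS (dS u)) 0 s) (dS (dS (dS u)) 0 s))
      (fun s => hcoord (h.sm.dS.hS 0 s) i) (fun s => hcoord (h.sm.dS.dS.hS 0 s) i)
      (h.per.dS.lz 0 i) ((h.sm.dS.dS.dS.coord i).cont 0)
      (continuous_const.add (h.sm.dS.dS.dS.cdt 0)) (fun s _ => coord_abs_le _ i) hs
    rw [intervalIntegral.integral_add (by simp)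
      ((h.sm.dS.dS.dS.cdt 0).intervalIntegrable _ _)] at this
    simp only [intervalIntegral.integral_const, sub_zero, smul_eq_mul, mul_one] at this
    linarith
  have h1 : ∀ i : Fin 3, ∀ s ∈ Icc 0 l, |dS u 0 s i| ≤ l * (l + M) := by
    intro i s hs
    have := rolle_bound hl (f := fun s => u 0 s i) (b := fun _ => l + M)
      (fun s => hcoord (h.sm.hS 0 s) i) (fun s => hcoord (h.sm.dS.hS 0 s) i)
      (h.per.lz 0 i) ((h.sm.dS.dS.coord i).cont 0)
      continuous_const (fun s hs => h2 i s hs) hs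
    simpa [mul_add] using this
  exact ⟨dt_le_of_coord fun i => h2 i s hs, dt_le_of_coord fun i => h1 i s hs⟩

/-- global in time bounds at the `H²` level -/
theorem Sol.H2 {l e : ℝ} (hl : 0 < l) {u : ℝ → ℝ → R3} (h : Sol l u)
    (h1 : ∫ s in (0:ℝ)..l, dt (dS u 0 s) (dS u 0 s) ≤ e)
    (h2 : ∫ s in (0:ℝ)..l, dt (dT u 0 s) (dT u 0 s) ≤ e) (t : ℝ) :
    (∫ s in (0:ℝ)..l, dt (dT u t s) (dT u t s)) ≤ 2 * e + (e / l + (e + 1) * e) * e ∧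
    ∀ s ∈ Icc 0 l, dt (dS u t s) (dS u t s) ≤ 
      (e / l + (e + 1) * e) + (2 * e + (e / l + (e + 1) * e) * e) := by
  set y := ∫ s in (0:ℝ)..l, dt (dT u t s) (dT u t s) with hy
  have hy0 : 0 ≤ y := int_dt_nonneg hl _
  have he : 0 ≤ e := (int_dt_nonneg hl _).trans h1
  have hx := h.E1 t
  set x := ∫ s in (0:ℝ)..l, dt (dS u t s) (dS u t s) with hxd
  have hxe : x ≤ e := by rw [hx]; exact h1
  have hx0 : 0 ≤ x := int_dt_nonneg hl _
  have hsup : ∀ s ∈ Icc 0 l, dt (dS u t s) (dS u t s) ≤ (e / l + (e + 1) * e) + y / (e + 1) := by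
    intro s hs
    have := sup_bound hl (g := fun s => dt (dS u t s) (dS u t s))
      (b := fun s => 1 / (e + 1) * dt (dT u t s) (dT u t s)
        + (e + 1) * dt (dS u t s) (dS u t s))
      (fun s => hdt (h.sm.dS.hS t s) (h.sm.dS.hS t s))
      (((h.sm.dS.dS.dt h.sm.dS).cont t).add ((h.sm.dS.dt h.sm.dS.dS).cont t))
      (((h.sm.dT.cdt t).const_mul _).add ((h.sm.dS.cdt t).const_mul _)) (fun s _ => by
        rw [dt_comm (dS (dS u) t s) (dS u t s), ← two_mul, abs_mul, abs_two, dt_self, dt_self]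
        have k := h.us_uss_le t s
        have k2 : 0 < e + 1 := by linarith
        have k3 : 0 ≤ (‖dT u t s‖ - (e + 1) * ‖dS u t s‖) ^ 2 / (e + 1) := by positivity
        have k4 : (‖dT u t s‖ - (e + 1) * ‖dS u t s‖) ^ 2 / (e + 1) =
          1 / (e + 1) * ‖dT u t s‖ ^ 2 + (e + 1) * ‖dS u t s‖ ^ 2
            - 2 * (‖dT u t s‖ * ‖dS u t s‖) := by field_simp; ring
        linarith) hs
    rw [intervalIntegral.integral_add (((h.sm.dT.cdt t).const_mul _).intervalIntegrable _ _)
      (((h.sm.dS.cdt t).const_mul _).intervalIntegrable _ _),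
      intervalIntegral.integral_const_mul, intervalIntegral.integral_const_mul, ← hy, ← hxd] at this
    have k1 : 1 / l * x ≤ e / l := by
      rw [one_div_mul_eq_div]; gcongr
    have k2 : (e + 1) * x ≤ (e + 1) * e := by gcongr
    have k3 : 1 / (e + 1) * y = y / (e + 1) := by ring
    linarith
  set B := e / l + (e + 1) * e with hB
  have hB0 : 0 ≤ B := by positivity
  have hE2 := h.E2 t
  have c4 : Continuous fun s => 1 / 4 * (dt (dS u t s) (dS u t s) * dt (dS u t s) (dS u t s)) :=
    ((h.sm.dS.cdt t).mul (h.sm.dS.cdt t)).const_mul _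
  have c40 : Continuous fun s => 1 / 4 * (dt (dS u 0 s) (dS u 0 s) * dt (dS u 0 s) (dS u 0 s)) :=
    ((h.sm.dS.cdt 0).mul (h.sm.dS.cdt 0)).const_mul _
  rw [intervalIntegral.integral_sub ((h.sm.dT.cdt t).intervalIntegrable _ _)
    (c4.intervalIntegrable _ _), intervalIntegral.integral_sub
    ((h.sm.dT.cdt 0).intervalIntegrable _ _) (c40.intervalIntegrable _ _), ← hy] at hE2
  have hn : 0 ≤ ∫ s in (0:ℝ)..l, 1 / 4 * (dt (dS u 0 s) (dS u 0 s) * dt (dS u 0 s) (dS u 0 s)) :=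
    intervalIntegral.integral_nonneg hl.le fun s _ => by
      have := dt_nonneg (dS u 0 s); positivity
  have hq := (le_abs_self _).trans (lin3 hl (f := fun s => 1 / 4 * (dt (dS u t s) (dS u t s)
    * dt (dS u t s) (dS u t s))) 0 (1 / 4 * (B + y / (e + 1))) 0 0 (h.sm.dS.cdt t) (h.sm.dS.cdt t)
    (h.sm.dS.cdt t) (fun s hs => by
      have k := dt_nonneg (dS u t s)
      rw [abs_of_nonneg (by positivity)]
      nlinarith [mul_le_mul_of_nonneg_right (hsup s hs) k]))
  simp only [zero_mul, zero_add, add_zero, ← hxd] at hq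
  have hye : y / (e + 1) * e ≤ y := by
    rw [div_mul_eq_mul_div, div_le_iff₀ (by linarith)]; nlinarith
  have hq2 : (1 / 4 * (B + y / (e + 1))) * x ≤ (1 / 4 * (B + y / (e + 1))) * e := by
    gcongr
  have hy1 : y ≤ 2 * e + B * e := by nlinarith [mul_nonneg hB0 he]
  refine ⟨hy1, fun s hs => (hsup s hs).trans ?_⟩
  have : y / (e + 1) ≤ y := div_le_self hy0 (by linarith)
  linarith

/-- `H³` bound -/
theorem Sol.H3 {l T Y0 K1 Y00 : ℝ} (hl : 0 < l) {u : ℝ → ℝ → R3} (h : Sol l u)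
    (hy : ∀ t, (∫ s in (0:ℝ)..l, dt (dT u t s) (dT u t s)) ≤ Y0)
    (hk : ∀ t, ∀ s ∈ Icc 0 l, dt (dS u t s) (dS u t s) ≤ K1)
    (h0 : (∫ s in (0:ℝ)..l, dt (dS (dT u) 0 s) (dS (dT u) 0 s)) ≤ Y00) :
    ∀ t ∈ Icc (-T) T, (∫ s in (0:ℝ)..l, dt (dS (dT u) t s) (dS (dT u) t s)) ≤
      (1 + Y00) * Real.exp ((5 + 4 * K1 * (1 / l + 1) * Y0 * (Y0 + 1) + K1 ^ 3 * Y0) * T) := by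
  have hK1 : 0 ≤ K1 := (dt_nonneg _).trans (hk 0 0 ⟨le_refl 0, hl.le⟩)
  have hY0 : 0 ≤ Y0 := (int_dt_nonneg hl _).trans (hy 0)
  set C := 5 + 4 * K1 * (1 / l + 1) * Y0 * (Y0 + 1) + K1 ^ 3 * Y0 with hC
  have hC0 : 0 ≤ C := by positivity
  have main := gronwall (T := T) (K := C) (f := fun t => 1 +
      ∫ s in (0:ℝ)..l, dt (dS (dT u) t s) (dS (dT u) t s)) 
    (fun t => (h.E3 t).const_add 1) (fun t ht => by
      set Y := ∫ s in (0:ℝ)..l, dt (dS (dT u) t s) (dS (dT u) t s) with hY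
      have hY0' : 0 ≤ Y := int_dt_nonneg hl _
      set S := (1 / l + 1) * (Y0 + Y) with hS
      have hSn : 0 ≤ S := by positivity
      have hsup : ∀ s ∈ Icc 0 l, dt (dT u t s) (dT u t s) ≤ S := fun s hs => by
        refine (vsup hl h.sm.dT t hs).trans ?_
        rw [hS]
        have := hy t
        gcongr
      refine (lin3 hl 0 5 (4 * S * K1 + K1 ^ 3) 0 (h.sm.dT.dS.cdt t) (h.sm.dT.cdt t)
        (h.sm.dT.cdt t) (fun s hs => ?_)).trans ?_
      · have q1 := h.us_uss_le t s
        have q2 := abs_tr_le (dS (dT u) t s) (u t s) (dT u t s)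
        rw [h.norm_u, mul_one] at q2
        have q3 := abs_tr_le (dS (dT u) t s) (dS u t s) (dT u t s)
        have q4 := abs_dt_le (dS (dT u) t s) (dS u t s)
        have q5 := hsup s hs
        have q6 := hk t s hs
        rw [dt_self] at q5 q6
        simp only [dt_self]
        have a0 := norm_nonneg (dS (dT u) t s)
        have b0 := norm_nonneg (dT u t s)
        have c0 := norm_nonneg (dS u t s)
        have m1 := mul_le_mul q1 q2 (abs_nonneg _) (by positivity)
        rw [← abs_mul] at m1
        have m2 := mul_le_mul_of_nonneg_left q3 (sq_nonneg ‖dS u t s‖)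
        have m3 := mul_le_mul_of_nonneg_left q4 (sq_nonneg ‖dT u t s‖)
        have t1 : |4 * (dt (dS u t s) (dS (dS u) t s) * dt (dS (dT u) t s) (cross3 (u t s) (dT u t s)))
            + 2 * (‖dS u t s‖ ^ 2 * dt (dS (dT u) t s) (cross3 (dS u t s) (dT u t s)))
            - 4 * (‖dT u t s‖ ^ 2 * dt (dS (dT u) t s) (dS u t s))| ≤ 
            4 * |dt (dS u t s) (dS (dS u) t s) * dt (dS (dT u) t s) (cross3 (u t s) (dT u t s))|
            + 2 * (‖dS u t s‖ ^ 2 * |dt (dS (dT u) t s) (cross3 (dS u t s) (dT u t s))|)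
            + 4 * (‖dT u t s‖ ^ 2 * |dt (dS (dT u) t s) (dS u t s)|) := by
          refine (abs_sub _ _).trans (add_le_add ((abs_add_le _ _).trans (add_le_add ?_ ?_)) ?_)
          · rw [abs_mul, abs_of_nonneg (by norm_num : (0:ℝ) ≤ 4)]
          · rw [abs_mul, abs_mul, abs_of_nonneg (by norm_num : (0:ℝ) ≤ 2),
              abs_of_nonneg (sq_nonneg _)]
          · rw [abs_mul, abs_mul, abs_of_nonneg (by norm_num : (0:ℝ) ≤ 4),
              abs_of_nonneg (sq_nonneg _)]
        refine t1.trans ?_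
        generalize ‖dS (dT u) t s‖ = a at *
        generalize ‖dT u t s‖ = b at *
        generalize ‖dS u t s‖ = c at *
        have r1 : 2 * (a * (b ^ 2 * c)) ≤ a ^ 2 + (b ^ 2 * c) ^ 2 := by
          nlinarith [sq_nonneg (a - b ^ 2 * c)]
        have r2 : 2 * (a * (c ^ 3 * b)) ≤ a ^ 2 + (c ^ 3 * b) ^ 2 := by
          nlinarith [sq_nonneg (a - c ^ 3 * b)]
        have r3 : (b ^ 2 * c) ^ 2 ≤ S * K1 * b ^ 2 := by
          have : (b ^ 2 * c) ^ 2 = (b ^ 2 * c ^ 2) * b ^ 2 := by ring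
          rw [this]; gcongr
        have r4 : (c ^ 3 * b) ^ 2 ≤ K1 ^ 3 * b ^ 2 := by
          have : (c ^ 3 * b) ^ 2 = (c ^ 2) ^ 3 * b ^ 2 := by ring
          rw [this]; gcongr
        nlinarith
      · rw [← hY]
        have e1 := hy t
        have e2 : (4 * S * K1 + K1 ^ 3) * (∫ s in (0:ℝ)..l, dt (dT u t s) (dT u t s)) ≤
          (4 * S * K1 + K1 ^ 3) * Y0 := by gcongr
        have e3 : S ≤ (1 / l + 1) * ((Y0 + 1) * (1 + Y)) := by
          rw [hS]; gcongr; nlinarith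
        have e4 : 4 * S * K1 * Y0 ≤ 4 * ((1 / l + 1) * ((Y0 + 1) * (1 + Y))) * K1 * Y0 := by gcongr
        have e5 : 0 ≤ K1 ^ 3 * Y0 * Y := by positivity
        rw [hC]
        nlinarith)
  intro t ht
  have hm := main t ht
  have h3 : |t| ≤ T := abs_le.2 ht
  have h4 := int_dt_nonneg hl (dS (dT u) 0)
  have h5 : 0 ≤ 1 + Y00 := by linarith
  calc _ ≤ (1 + ∫ s in (0:ℝ)..l, dt (dS (dT u) 0 s) (dS (dT u) 0 s)) * Real.exp (C * |t|) := by
        linarith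
    _ ≤ _ := by gcongr

set_option maxHeartbeats 1000000 in
/-- all a priori bounds -/
theorem apriori (l T M : ℝ) (hl : 0 < l) (hM : 0 < M) : ∃ K : ℝ, 1 ≤ K ∧ ∀ u : ℝ → ℝ → R3,
    Sol l u → (∫ s in (0:ℝ)..l, dt (dS (dS (dS u)) 0 s) (dS (dS (dS u)) 0 s) ≤ M) →
    ∀ t ∈ Icc (-T) T, (∀ s ∈ Icc 0 l, ‖dS u t s‖ ≤ K ∧ ‖dS (dS u) t s‖ ≤ K ∧ ‖dT u t s‖ ≤ K) ∧
      (∫ s in (0:ℝ)..l, dt (dS (dT u) t s) (dS (dT u) t s)) ≤ K ∧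
      (∫ s in (0:ℝ)..l, dt (dS (dS (dS u)) t s) (dS (dS (dS u)) t s)) ≤ K := by
  obtain ⟨A1, hA1⟩ : ∃ x : ℝ, x = 3 * (l + M) ^ 2 := ⟨_, rfl⟩
  obtain ⟨A2, hA2⟩ : ∃ x : ℝ, x = 3 * (l * (l + M)) ^ 2 := ⟨_, rfl⟩
  have hA10 : 0 ≤ A1 := by rw [hA1]; positivity
  have hA20 : 0 ≤ A2 := by rw [hA2]; positivity
  obtain ⟨e, he⟩ : ∃ x : ℝ, x = (A1 + A2) * l := ⟨_, rfl⟩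
  have he0 : 0 ≤ e := by rw [he]; positivity
  obtain ⟨Y0, hY0⟩ : ∃ x : ℝ, x = 2 * e + (e / l + (e + 1) * e) * e := ⟨_, rfl⟩
  obtain ⟨K1, hK1⟩ : ∃ x : ℝ, x = (e / l + (e + 1) * e) + Y0 := ⟨_, rfl⟩
  have hY00 : 0 ≤ Y0 := by rw [hY0]; positivity
  have hK10 : 0 ≤ K1 := by rw [hK1]; positivity
  obtain ⟨Y00, hYY⟩ : ∃ x : ℝ, x = 2 * (A2 * A1) * l + 2 * M := ⟨_, rfl⟩
  have hYY0 : 0 ≤ Y00 := by rw [hYY]; positivity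
  obtain ⟨Y1, hY1⟩ : ∃ x : ℝ, x = (1 + Y00) * Real.exp ((5 + 4 * K1 * (1 / l + 1) * Y0 * (Y0 + 1) + K1 ^ 3 * Y0) * T) := ⟨_, rfl⟩
  have hY10 : 0 ≤ Y1 := by rw [hY1]; positivity
  obtain ⟨K2, hK2⟩ : ∃ x : ℝ, x = (1 / l + 1) * (Y0 + Y1) := ⟨_, rfl⟩
  have hK20 : 0 ≤ K2 := by rw [hK2]; positivity
  obtain ⟨K3, hK3⟩ : ∃ x : ℝ, x = 11 * (K1 * (K2 + K1 ^ 2)) * l + 2 * Y1 := ⟨_, rfl⟩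
  have hK30 : 0 ≤ K3 := by rw [hK3]; positivity
  refine ⟨1 + K1 + K2 + K1 ^ 2 + Y1 + K3, by nlinarith [sq_nonneg K1], ?_⟩
  intro u h h0
  have hi := fun s hs => h.init hl h0 (s := s) hs
  simp only [← hA1, ← hA2] at hi
  have usq : ∀ t s, dt (dT u t s) (dT u t s) ≤ dt (dS (dS u) t s) (dS (dS u) t s) := fun t s => by
    rw [h.uss_sq]; nlinarith [sq_nonneg (dt (dS u t s) (dS u t s))]
  have h1 : ∫ s in (0:ℝ)..l, dt (dS u 0 s) (dS u 0 s) ≤ e := by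
    refine ((le_abs_self _).trans (lin3 hl A2 0 0 0 (h.sm.dS.cdt 0) (h.sm.dS.cdt 0)
      (h.sm.dS.cdt 0) (fun s hs => ?_))).trans ?_
    · rw [abs_of_nonneg (dt_nonneg _)]; linarith [(hi s hs).2]
    · rw [he]; nlinarith
  have h2 : ∫ s in (0:ℝ)..l, dt (dT u 0 s) (dT u 0 s) ≤ e := by
    refine ((le_abs_self _).trans (lin3 hl A1 0 0 0 (h.sm.dS.cdt 0) (h.sm.dS.cdt 0)
      (h.sm.dS.cdt 0) (fun s hs => ?_))).trans ?_
    · rw [abs_of_nonneg (dt_nonneg _)]; linarith [(hi s hs).1, usq 0 s]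
    · rw [he]; nlinarith
  have hH2 := h.H2 hl h1 h2
  simp only [← hY0, ← hK1] at hH2
  have h3 : (∫ s in (0:ℝ)..l, dt (dS (dT u) 0 s) (dS (dT u) 0 s)) ≤ Y00 := by
    refine ((le_abs_self _).trans (lin3 hl (2 * (A2 * A1)) 2 0 0 (h.sm.dS.dS.dS.cdt 0)
      (h.sm.dS.cdt 0) (h.sm.dS.cdt 0) (fun s hs => ?_))).trans ?_
    · rw [abs_of_nonneg (dt_nonneg _), h.p_s]
      have a1 := (hi s hs).1
      have a2 := (hi s hs).2
      have b1 := norm_cr_le (dS u 0 s) (dS (dS u) 0 s)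
      have b2 := norm_cr_le (u 0 s) (dS (dS (dS u)) 0 s)
      rw [h.norm_u, one_mul] at b2
      have b3 := norm_add_le (cross3 (dS u 0 s) (dS (dS u) 0 s))
        (cross3 (u 0 s) (dS (dS (dS u)) 0 s))
      rw [dt_self] at a1 a2
      rw [dt_self, dt_self]
      have b4 : ‖cross3 (dS u 0 s) (dS (dS u) 0 s) + cross3 (u 0 s) (dS (dS (dS u)) 0 s)‖ ^ 2 ≤
          (‖dS u 0 s‖ * ‖dS (dS u) 0 s‖ + ‖dS (dS (dS u)) 0 s‖) ^ 2 := by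
        gcongr; linarith
      have b5 : ‖dS u 0 s‖ ^ 2 * ‖dS (dS u) 0 s‖ ^ 2 ≤ A2 * A1 := by gcongr
      nlinarith [sq_nonneg (‖dS u 0 s‖ * ‖dS (dS u) 0 s‖ - ‖dS (dS (dS u)) 0 s‖)]
    · rw [hYY]; linarith
  have hH3 := h.H3 (T := T) hl (fun t => (hH2 t).1) (fun t => (hH2 t).2) h3
  simp only [← hY1] at hH3
  intro t ht
  have hp : ∀ s ∈ Icc 0 l, dt (dT u t s) (dT u t s) ≤ K2 := fun s hs => by
    refine (vsup hl h.sm.dT t hs).trans ?_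
    have a1 := (hH2 t).1
    have a2 := hH3 t ht
    rw [hK2]; gcongr
  have hus := (hH2 t).2
  have huss : ∀ s ∈ Icc 0 l, dt (dS (dS u) t s) (dS (dS u) t s) ≤ K2 + K1 ^ 2 := fun s hs => by
    rw [h.uss_sq]
    have a1 := hp s hs
    have a2 := hus s hs
    have a3 := dt_nonneg (dS u t s)
    gcongr
  have sqle : ∀ x k : ℝ, 0 ≤ k → x ^ 2 ≤ k → x ≤ 1 + k := fun x k hk hx => by
    nlinarith [sq_nonneg (x - 1)]
  have hsq := sq_nonneg K1
  refine ⟨fun s hs => ⟨?_, ?_, ?_⟩, ?_, ?_⟩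
  · have := hus s hs
    rw [dt_self] at this
    linarith [sqle _ _ hK10 this]
  · have := huss s hs
    rw [dt_self] at this
    linarith [sqle _ _ (by positivity) this]
  · have := hp s hs
    rw [dt_self] at this
    linarith [sqle _ _ (by positivity) this]
  · linarith [hH3 t ht]
  · refine ((le_abs_self _).trans (lin3 hl (11 * (K1 * (K2 + K1 ^ 2))) 2 0 0 (h.sm.dT.dS.cdt t)
      (h.sm.dS.cdt 0) (h.sm.dS.cdt 0) (fun s hs => ?_))).trans ?_
    · rw [abs_of_nonneg (dt_nonneg _)]
      have a1 := huss s hs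
      have a2 := hus s hs
      have b0 := norm_cr_sq (u t s) (dS (dS (dS u)) t s)
      rw [h.norm_u, h.usss_u] at b0
      have b1 : cross3 (u t s) (dS (dS (dS u)) t s) = 
        dS (dT u) t s - cross3 (dS u t s) (dS (dS u) t s) := by rw [h.p_s]; abel
      rw [b1] at b0
      have b2 := norm_sub_le (dS (dT u) t s) (cross3 (dS u t s) (dS (dS u) t s))
      have b3 := norm_cr_le (dS u t s) (dS (dS u) t s)
      have b4 := abs_dt_le (dS u t s) (dS (dS u) t s)
      rw [dt_self] at a1 a2
      rw [dt_self, dt_self]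
      have b5 : ‖dS u t s‖ ^ 2 * ‖dS (dS u) t s‖ ^ 2 ≤ K1 * (K2 + K1 ^ 2) := by gcongr
      have b6 : dt (dS u t s) (dS (dS u) t s) ^ 2 ≤ (‖dS u t s‖ * ‖dS (dS u) t s‖) ^ 2 :=
        sq_le_sq' (abs_le.1 b4).1 (abs_le.1 b4).2
      have b7 : ‖dS (dT u) t s - cross3 (dS u t s) (dS (dS u) t s)‖ ^ 2 ≤
        (‖dS (dT u) t s‖ + ‖dS u t s‖ * ‖dS (dS u) t s‖) ^ 2 := by gcongr; linarith
      nlinarith [sq_nonneg (‖dS (dT u) t s‖ - ‖dS u t s‖ * ‖dS (dS u) t s‖)]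
    · have := hH3 t ht
      linarith

end SM

namespace SM

theorem abs_mul_le' {x y A B : ℝ} (hx : |x| ≤ A) (hy : |y| ≤ B) : |x * y| ≤ A * B := by
  rw [abs_mul]; exact mul_le_mul hx hy (abs_nonneg _) ((abs_nonneg _).trans hx)

theorem young {W W1 W2 Z a b K S : ℝ} (hW : 0 ≤ W) (hW1 : 0 ≤ W1)
    (hZ : 0 ≤ Z) (ha : 0 ≤ a) (hb : 0 ≤ b) (hK : 1 ≤ K) (hWS : W ^ 2 ≤ S) (hWS1 : W1 ^ 2 ≤ S) :
    Z * (K * W2) + (a * W + K * W1 + K * Z) * (W * b) + (1 / 2 * W ^ 2) * (b * a)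
      + (b * K + K * K) * (Z * W) + K * K * (K * Z * W) + K * K * (Z * W1) + Z * W1 * a
      + (a * W + K * W1) * (K * Z) + K * W * (K * Z) + (a * W + K * W1 + K * Z) * (Z * K) ≤
    20 * K ^ 3 * (W ^ 2 + W1 ^ 2 + W2 ^ 2 + Z ^ 2 + S * (a ^ 2 + b ^ 2)) := by
  obtain ⟨V, hV⟩ : ∃ V, V = W ^ 2 + W1 ^ 2 + W2 ^ 2 + Z ^ 2 + S * (a ^ 2 + b ^ 2) := ⟨_, rfl⟩
  have hS : 0 ≤ S := (sq_nonneg _).trans hWS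
  have p1 : W ^ 2 * b ^ 2 ≤ S * b ^ 2 := by gcongr
  have p2 : W ^ 2 * a ^ 2 ≤ S * a ^ 2 := by gcongr
  have p3 : W1 ^ 2 * a ^ 2 ≤ S * a ^ 2 := by gcongr
  have p4 : 0 ≤ S * a ^ 2 := by positivity
  have p5 : 0 ≤ S * b ^ 2 := by positivity
  have qW := sq_nonneg W
  have qW1 := sq_nonneg W1
  have qW2 := sq_nonneg W2
  have qZ := sq_nonneg Z
  have yg : ∀ x y : ℝ, 2 * (x * y) ≤ x ^ 2 + y ^ 2 := fun x y => by nlinarith [sq_nonneg (x - y)]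
  have v1 : Z * W2 ≤ V := by rw [hV]; linarith [yg Z W2]
  have v2 : (a * W) * (W * b) ≤ V := by rw [hV]; linarith [yg (a * W) (W * b)]
  have v3 : W1 * (W * b) ≤ V := by rw [hV]; linarith [yg W1 (W * b)]
  have v4 : Z * (W * b) ≤ V := by rw [hV]; linarith [yg Z (W * b)]
  have v5 : Z * W ≤ V := by rw [hV]; linarith [yg Z W]
  have v6 : Z * W1 ≤ V := by rw [hV]; linarith [yg Z W1]
  have v7 : Z * (W1 * a) ≤ V := by rw [hV]; linarith [yg Z (W1 * a)]
  have v8 : Z * (a * W) ≤ V := by rw [hV]; linarith [yg Z (a * W)]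
  have v9 : Z ^ 2 ≤ V := by rw [hV]; linarith
  have hV0 : 0 ≤ V := qZ.trans v9
  have k2 : K ≤ K ^ 3 := by nlinarith [sq_nonneg K, mul_nonneg (by linarith : 0 ≤ K - 1) (by positivity : 0 ≤ K * (K + 1))]
  have k3 : K ^ 2 ≤ K ^ 3 := by nlinarith [mul_nonneg (by linarith : 0 ≤ K - 1) (sq_nonneg K)]
  have k1 : 1 ≤ K ^ 3 := hK.trans k2
  have m0 : ∀ x, x ≤ V → x ≤ K ^ 3 * V := fun x hx => by nlinarith
  have m1 : ∀ x, x ≤ V → K * x ≤ K ^ 3 * V := fun x hx =>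
    (mul_le_mul_of_nonneg_left hx (by linarith)).trans (mul_le_mul_of_nonneg_right k2 hV0)
  have m2 : ∀ x, x ≤ V → K ^ 2 * x ≤ K ^ 3 * V := fun x hx =>
    (mul_le_mul_of_nonneg_left hx (by positivity)).trans (mul_le_mul_of_nonneg_right k3 hV0)
  have m3 : ∀ x, x ≤ V → K ^ 3 * x ≤ K ^ 3 * V := fun x hx =>
    mul_le_mul_of_nonneg_left hx (by positivity)
  have hKV : 0 ≤ K ^ 3 * V := by positivity
  rw [← hV]
  have e : Z * (K * W2) + (a * W + K * W1 + K * Z) * (W * b) + (1 / 2 * W ^ 2) * (b * a)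
      + (b * K + K * K) * (Z * W) + K * K * (K * Z * W) + K * K * (Z * W1) + Z * W1 * a
      + (a * W + K * W1) * (K * Z) + K * W * (K * Z) + (a * W + K * W1 + K * Z) * (Z * K) =
      K * (Z * W2) + (3 / 2) * ((a * W) * (W * b)) + K * (W1 * (W * b)) + 2 * (K * (Z * (W * b)))
      + 2 * (K ^ 2 * (Z * W)) + K ^ 3 * (Z * W) + 3 * (K ^ 2 * (Z * W1)) + Z * (W1 * a)
      + 2 * (K * (Z * (a * W))) + K ^ 2 * Z ^ 2 := by ring
  rw [e]
  linarith [m1 _ v1, m0 _ v2, m1 _ v3, m1 _ v4, m2 _ v5, m3 _ v5, m2 _ v6, m0 _ v7, m1 _ v8,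
    m2 _ v9]

/-- pointwise comparison of `w_ss` and `z` -/
theorem wss_le {l : ℝ} {u v : ℝ → ℝ → R3} (hu : Sol l u) (hv : Sol l v) {K : ℝ} (hK : 1 ≤ K)
    {t s : ℝ} (h1 : ‖dS u t s‖ ≤ K) (h2 : ‖dS v t s‖ ≤ K) (h3 : ‖dS (dS v) t s‖ ≤ K) :
    dt (dS (dS u) t s - dS (dS v) t s) (dS (dS u) t s - dS (dS v) t s) ≤
      8 * K ^ 2 * (dt (u t s - v t s) (u t s - v t s)
        + dt (dS u t s - dS v t s) (dS u t s - dS v t s)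
        + dt (dT u t s - dT v t s) (dT u t s - dT v t s)) := by
  have a1 := norm_cr_sq (u t s) (dS (dS u) t s - dS (dS v) t s)
  have a2 : cross3 (u t s) (dS (dS u) t s - dS (dS v) t s) =
    (dT u t s - dT v t s) - cross3 (u t s - v t s) (dS (dS v) t s) := by
    rw [z_eq hu hv]; abel
  rw [hu.norm_u, u_wss hu hv, a2] at a1
  have b1 := norm_sub_le (dT u t s - dT v t s) (cross3 (u t s - v t s) (dS (dS v) t s))
  have b2 := norm_cr_le (u t s - v t s) (dS (dS v) t s)
  have b3 := abs_dt_le (dS u t s - dS v t s) (dS u t s + dS v t s)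
  have b4 := norm_add_le (dS u t s) (dS v t s)
  have b5 := abs_dt_le (u t s - v t s) (dS (dS v) t s)
  simp only [dt_self]
  have n0 := norm_nonneg (u t s - v t s)
  have n1 := norm_nonneg (dS u t s - dS v t s)
  have n2 := norm_nonneg (dT u t s - dT v t s)
  have b6 : ‖u t s - v t s‖ * ‖dS (dS v) t s‖ ≤ ‖u t s - v t s‖ * K := by gcongr
  have b7 : ‖dS u t s - dS v t s‖ * ‖dS u t s + dS v t s‖ ≤ ‖dS u t s - dS v t s‖ * (2 * K) := by
    gcongr; linarith
  have c1 : ‖dT u t s - dT v t s - cross3 (u t s - v t s) (dS (dS v) t s)‖ ^ 2 ≤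
    (‖dT u t s - dT v t s‖ + ‖u t s - v t s‖ * K) ^ 2 := by gcongr; linarith
  have c2 : (-dt (dS u t s - dS v t s) (dS u t s + dS v t s)
      - dt (u t s - v t s) (dS (dS v) t s)) ^ 2 ≤
      (‖dS u t s - dS v t s‖ * (2 * K) + ‖u t s - v t s‖ * K) ^ 2 := by
    have := abs_le.1 b3
    have := abs_le.1 b5
    apply sq_le_sq' <;> linarith
  have hK2 : 1 ≤ K ^ 2 := by nlinarith
  have e1 := sq_nonneg (‖dT u t s - dT v t s‖ - ‖u t s - v t s‖ * K)
  have e2 := sq_nonneg (‖dS u t s - dS v t s‖ * (2 * K) - ‖u t s - v t s‖ * K)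
  have e3 := mul_nonneg (by linarith : 0 ≤ K ^ 2 - 1) (sq_nonneg ‖dT u t s - dT v t s‖)
  have e4 := mul_nonneg (sq_nonneg K) (sq_nonneg ‖u t s - v t s‖)
  have e5 := mul_nonneg (sq_nonneg K) (sq_nonneg ‖dT u t s - dT v t s‖)
  have e6 := mul_nonneg (sq_nonneg K) (sq_nonneg ‖dS u t s - dS v t s‖)
  nlinarith

theorem z_le {l : ℝ} {u v : ℝ → ℝ → R3} (hu : Sol l u) (hv : Sol l v) {K : ℝ}
    {t s : ℝ} (h3 : ‖dS (dS v) t s‖ ≤ K) :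
    dt (dT u t s - dT v t s) (dT u t s - dT v t s) ≤
      2 * dt (dS (dS u) t s - dS (dS v) t s) (dS (dS u) t s - dS (dS v) t s)
      + 2 * K ^ 2 * dt (u t s - v t s) (u t s - v t s) := by
  rw [z_eq hu hv]
  have b1 := norm_add_le (cross3 (u t s) (dS (dS u) t s - dS (dS v) t s))
    (cross3 (u t s - v t s) (dS (dS v) t s))
  have b2 := norm_cr_le (u t s - v t s) (dS (dS v) t s)
  have b3 := norm_cr_le (u t s) (dS (dS u) t s - dS (dS v) t s)
  rw [hu.norm_u, one_mul] at b3
  simp only [dt_self]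
  have b6 : ‖u t s - v t s‖ * ‖dS (dS v) t s‖ ≤ ‖u t s - v t s‖ * K := by gcongr
  have c1 : ‖cross3 (u t s) (dS (dS u) t s - dS (dS v) t s) 
      + cross3 (u t s - v t s) (dS (dS v) t s)‖ ^ 2 ≤
    (‖dS (dS u) t s - dS (dS v) t s‖ + ‖u t s - v t s‖ * K) ^ 2 := by gcongr; linarith
  nlinarith [sq_nonneg (‖dS (dS u) t s - dS (dS v) t s‖ - ‖u t s - v t s‖ * K)]

/-- pointwise bound of the right side of the second order identity -/
theorem G2_le {l : ℝ} {u v : ℝ → ℝ → R3} (hu : Sol l u) (hv : Sol l v) {K S : ℝ} (hK : 1 ≤ K)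
    {t s : ℝ} (h2 : ‖dS v t s‖ ≤ K) (h3 : ‖dS (dS v) t s‖ ≤ K)
    (h4 : ‖dT u t s‖ ≤ K) (h5 : ‖dT v t s‖ ≤ K)
    (hS : dt (u t s - v t s) (u t s - v t s) ≤ S)
    (hS1 : dt (dS u t s - dS v t s) (dS u t s - dS v t s) ≤ S) :
    |G2 (u t s) (v t s) (dS u t s) (dS v t s) (dS (dS u) t s) (dS (dS v) t s)
      (dT u t s) (dT v t s) (dS (dT u) t s) (dS (dT v) t s)| ≤
    40 * K ^ 3 * (dt (u t s - v t s) (u t s - v t s)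
      + dt (dS u t s - dS v t s) (dS u t s - dS v t s)
      + dt (dS (dS u) t s - dS (dS v) t s) (dS (dS u) t s - dS (dS v) t s)
      + dt (dT u t s - dT v t s) (dT u t s - dT v t s)
      + S * (dt (dS (dT u) t s) (dS (dT u) t s) + dt (dS (dT v) t s) (dS (dT v) t s))) := by
  have k1 := v_zs hu hv t s
  have k2 := v_w (hu.unit t s) (hv.unit t s)
  have k3 := hv.norm_u t s
  have k4 : dt (dT u t s - dT v t s) (cross3 (dT u t s) (dS (dS u) t s)
      - cross3 (dT v t s) (dS (dS v) t s)) = dt (dT u t s - dT v t s)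
      (cross3 (dT v t s) (dS (dS u) t s - dS (dS v) t s)) := by
    simp only [dt, cr0, cr1, cr2, PiLp.sub_apply]; ring
  have hD : |dt (v t s) (dS (dT u) t s - dS (dT v) t s)| ≤ ‖dS (dT u) t s‖ * ‖u t s - v t s‖
      + K * ‖dS u t s - dS v t s‖ + K * ‖dT u t s - dT v t s‖ := by
    have a1 := abs_le.1 (abs_dt_le (dS (dT u) t s) (u t s - v t s))
    have a2 := abs_le.1 ((abs_dt_le (dT u t s) (dS u t s - dS v t s)).trans
      (mul_le_mul_of_nonneg_right h4 (norm_nonneg _)))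
    have a3 := abs_le.1 ((abs_dt_le (dT u t s - dT v t s) (dS v t s)).trans
      (mul_le_mul_of_nonneg_left h2 (norm_nonneg _)))
    rw [k1, abs_le]; constructor <;> linarith
  simp only [G2, k4]
  rw [dt_self] at hS hS1
  simp only [dt_self] at k2 ⊢
  have hvw : |dt (v t s) (u t s - v t s)| ≤ 1 / 2 * ‖u t s - v t s‖ ^ 2 := by
    rw [k2, abs_le]; constructor <;> nlinarith [sq_nonneg ‖u t s - v t s‖]
  generalize u t s - v t s = w at *
  generalize v t s = v0 at *
  generalize dS u t s - dS v t s = w1 at *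
  generalize dS v t s = v1 at *
  generalize dS (dS u) t s - dS (dS v) t s = w2 at *
  generalize dS (dS v) t s = v2 at *
  generalize dT u t s - dT v t s = z at *
  generalize dT u t s = p at *
  generalize dT v t s = q at *
  generalize hzs : dt v0 (dS (dT u) t s - dS (dT v) t s) = nz at *
  generalize dS (dT u) t s = ps at *
  generalize dS (dT v) t s = qs at *
  have hK0 : 0 ≤ K := by linarith
  have Y := young (norm_nonneg w) (norm_nonneg w1) (W2 := ‖w2‖) (norm_nonneg z) (norm_nonneg ps)
    (norm_nonneg qs) hK hS hS1
  have t0 : |dt z (cross3 q w2)| ≤ ‖z‖ * (K * ‖w2‖) := by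
    refine (abs_tr_le _ _ _).trans ?_
    rw [mul_assoc]; gcongr
  have t1 : |nz * dt v0 (cross3 w qs)| ≤
      (‖ps‖ * ‖w‖ + K * ‖w1‖ + K * ‖z‖) * (‖w‖ * ‖qs‖) :=
    abs_mul_le' hD (by have := abs_tr_le v0 w qs; rwa [k3, one_mul] at this)
  have t2 : |dt v0 w * dt v0 (cross3 qs ps)| ≤ (1 / 2 * ‖w‖ ^ 2) * (‖qs‖ * ‖ps‖) :=
    abs_mul_le' hvw (by have := abs_tr_le v0 qs ps; rwa [k3, one_mul] at this)
  have t3 : |(dt qs v1 + dt q v2) * dt v0 (cross3 z w)| ≤ (‖qs‖ * K + K * K) * (‖z‖ * ‖w‖) := by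
    refine abs_mul_le' ((abs_add_le _ _).trans (add_le_add ?_ ?_)) 
      (by have := abs_tr_le v0 z w; rwa [k3, one_mul] at this)
    · refine (abs_dt_le _ _).trans ?_; gcongr
    · refine (abs_dt_le _ _).trans ?_; gcongr
  have hqv : |dt q v1| ≤ K * K := by
    refine (abs_dt_le _ _).trans ?_; gcongr
  have t4 : |dt q v1 * dt v1 (cross3 z w)| ≤ K * K * (K * ‖z‖ * ‖w‖) := by
    refine abs_mul_le' hqv ((abs_tr_le _ _ _).trans ?_); gcongr
  have t5 : |dt q v1 * dt v0 (cross3 z w1)| ≤ K * K * (‖z‖ * ‖w1‖) :=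
    abs_mul_le' hqv (by have := abs_tr_le v0 z w1; rwa [k3, one_mul] at this)
  have t6 : |dt z (cross3 w1 ps)| ≤ ‖z‖ * ‖w1‖ * ‖ps‖ := abs_tr_le _ _ _
  have t7 : |(dt ps w + dt p w1) * dt v0 (cross3 v1 z)| ≤ 
      (‖ps‖ * ‖w‖ + K * ‖w1‖) * (K * ‖z‖) := by
    refine abs_mul_le' ((abs_add_le _ _).trans (add_le_add (abs_dt_le _ _) ?_)) ?_
    · refine (abs_dt_le _ _).trans ?_; gcongr
    · have := abs_tr_le v0 v1 z
      rw [k3, one_mul] at this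
      exact this.trans (by gcongr)
  have t8 : |dt p w * dt v0 (cross3 v2 z)| ≤ K * ‖w‖ * (K * ‖z‖) := by
    refine abs_mul_le' ?_ ?_
    · refine (abs_dt_le _ _).trans ?_; gcongr
    · have := abs_tr_le v0 v2 z
      rw [k3, one_mul] at this
      exact this.trans (by gcongr)
  have t9 : |nz * dt v0 (cross3 z v1)| ≤
      (‖ps‖ * ‖w‖ + K * ‖w1‖ + K * ‖z‖) * (‖z‖ * K) := by
    refine abs_mul_le' hD ?_
    have := abs_tr_le v0 z v1
    rw [k3, one_mul] at this
    exact this.trans (by gcongr)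
  rw [abs_le] at t0 t1 t2 t3 t4 t5 t6 t7 t8 t9 ⊢
  constructor <;> linarith

theorem dS_sub {u v : ℝ → ℝ → R3} (hu : Sm u) (hv : Sm v) :
    dS (fun t s => u t s - v t s) = fun t s => dS u t s - dS v t s := by
  funext t s
  exact ((hu.hS t s).sub (hv.hS t s)).deriv

/-- the a priori estimate for the difference in `H¹` -/
theorem H1_rate {l K : ℝ} (hl : 0 < l) (hK : 1 ≤ K) {u v : ℝ → ℝ → R3} (hu : Sol l u)
    (hv : Sol l v) {t : ℝ} (hus : ∀ s ∈ Icc 0 l, ‖dS u t s‖ ≤ K)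
    (hv3 : (∫ s in (0:ℝ)..l, dt (dS (dS (dS v)) t s) (dS (dS (dS v)) t s)) ≤ K) :
    |∫ s in (0:ℝ)..l, (2 * dt (dS u t s - dS v t s) (cross3 (u t s - v t s) (dS (dS (dS v)) t s))
      - 2 * dt (u t s - v t s) (cross3 (dS u t s) (dS u t s - dS v t s)))| ≤
    (1 + K + (1 / l + 1) * K) * ∫ s in (0:ℝ)..l, (dt (u t s - v t s) (u t s - v t s)
      + dt (dS u t s - dS v t s) (dS u t s - dS v t s)) := by
  have w0 := hu.sm.sub hv.sm
  have w1 := hu.sm.dS.sub hv.sm.dS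
  have hsup := fun s hs => vsup hl w0 t (s := s) hs
  rw [dS_sub hu.sm hv.sm] at hsup
  have hadd := intervalIntegral.integral_add (μ := volume) ((w0.cdt t).intervalIntegrable 0 l)
    ((w1.cdt t).intervalIntegrable 0 l)
  simp only at hsup hadd
  rw [← hadd] at hsup
  obtain ⟨E, hE⟩ : ∃ E, E = ∫ s in (0:ℝ)..l, (dt (u t s - v t s) (u t s - v t s)
      + dt (dS u t s - dS v t s) (dS u t s - dS v t s)) := ⟨_, rfl⟩
  rw [← hE] at hsup
  rw [← hE]
  have hE0 : 0 ≤ E := by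
    rw [hE]; exact intervalIntegral.integral_nonneg hl.le fun s _ =>
      add_nonneg (dt_nonneg _) (dt_nonneg _)
  have hc : Continuous (fun s => dt (u t s - v t s) (u t s - v t s)
      + dt (dS u t s - dS v t s) (dS u t s - dS v t s)) := (w0.cdt t).add (w1.cdt t)
  refine (lin3 hl 0 (1 + K) ((1 / l + 1) * E) 0 hc
    (hv.sm.dS.dS.dS.cdt t) (hv.sm.dS.cdt t) (fun s hs => ?_)).trans ?_
  · have a1 := abs_tr_le (dS u t s - dS v t s) (u t s - v t s) (dS (dS (dS v)) t s)
    have a2 := abs_tr_le (u t s - v t s) (dS u t s) (dS u t s - dS v t s)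
    have a3 := hsup s hs
    have a4 := hus s hs
    simp only [dt_self] at a3 ⊢
    have b1 : ‖u t s - v t s‖ * ‖dS u t s‖ * ‖dS u t s - dS v t s‖ ≤
      ‖u t s - v t s‖ * K * ‖dS u t s - dS v t s‖ := by gcongr
    generalize ‖dS u t s - dS v t s‖ = x1 at *
    generalize ‖u t s - v t s‖ = x0 at *
    generalize ‖dS (dS (dS v)) t s‖ = x3 at *
    have c1 : x0 ^ 2 * x3 ^ 2 ≤ ((1 / l + 1) * E) * x3 ^ 2 := by gcongr
    have c2 := sq_nonneg (x1 - x0 * x3)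
    have c3 := mul_nonneg (by linarith : 0 ≤ K) (sq_nonneg (x0 - x1))
    have c4 := abs_le.1 a1
    have c5 := abs_le.1 a2
    rw [abs_le]; constructor <;> nlinarith [sq_nonneg x0, sq_nonneg x1]
  · rw [← hE]
    have : (1 / l + 1) * E * (∫ s in (0:ℝ)..l, dt (dS (dS (dS v)) t s) (dS (dS (dS v)) t s)) ≤
      (1 / l + 1) * E * K := by gcongr
    simp only [zero_mul, zero_add, add_zero]
    nlinarith

/-- rate of the second order energy -/
theorem H2_rate {l K : ℝ} (hl : 0 < l) (hK : 1 ≤ K) {u v : ℝ → ℝ → R3} (hu : Sol l u)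
    (hv : Sol l v) {t : ℝ}
    (bu : ∀ s ∈ Icc 0 l, ‖dS u t s‖ ≤ K ∧ ‖dS (dS u) t s‖ ≤ K ∧ ‖dT u t s‖ ≤ K)
    (bv : ∀ s ∈ Icc 0 l, ‖dS v t s‖ ≤ K ∧ ‖dS (dS v) t s‖ ≤ K ∧ ‖dT v t s‖ ≤ K)
    (pu : (∫ s in (0:ℝ)..l, dt (dS (dT u) t s) (dS (dT u) t s)) ≤ K)
    (pv : (∫ s in (0:ℝ)..l, dt (dS (dT v) t s) (dS (dT v) t s)) ≤ K) :
    |∫ s in (0:ℝ)..l, G2 (u t s) (v t s) (dS u t s) (dS v t s) (dS (dS u) t s) (dS (dS v) t s)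
      (dT u t s) (dT v t s) (dS (dT u) t s) (dS (dT v) t s)| ≤
    (40 * K ^ 3 * (1 + 8 * K ^ 2) * (1 + 2 * (1 / l + 1) * K)) *
      ((∫ s in (0:ℝ)..l, (dt (u t s - v t s) (u t s - v t s)
      + dt (dS u t s - dS v t s) (dS u t s - dS v t s))) +
      ∫ s in (0:ℝ)..l, dt (dT u t s - dT v t s) (dT u t s - dT v t s)) := by
  have w0 := hu.sm.sub hv.sm
  have w1 := hu.sm.dS.sub hv.sm.dS
  have w2 := hu.sm.dS.dS.sub hv.sm.dS.dS
  have z0 := hu.sm.dT.sub hv.sm.dT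
  have hsup := fun s hs => vsup hl w0 t (s := s) hs
  rw [dS_sub hu.sm hv.sm] at hsup
  have hsup1 := fun s hs => vsup hl w1 t (s := s) hs
  rw [dS_sub hu.sm.dS hv.sm.dS] at hsup1
  have hadd := intervalIntegral.integral_add (μ := volume) ((w0.cdt t).intervalIntegrable 0 l)
    ((w1.cdt t).intervalIntegrable 0 l)
  have hw2 := (le_abs_self _).trans (lin3 hl 0 (8 * K ^ 2) (8 * K ^ 2) (8 * K ^ 2)
    (w0.cdt t) (w1.cdt t) (z0.cdt t) (f := fun s => dt (dS (dS u) t s - dS (dS v) t s)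
      (dS (dS u) t s - dS (dS v) t s)) (fun s hs => by
      rw [abs_of_nonneg (dt_nonneg _)]
      have := wss_le hu hv hK (bu s hs).1 (bv s hs).1 (bv s hs).2.1
      linarith))
  have i0 := int_dt_nonneg hl (fun s => u t s - v t s)
  have i1 := int_dt_nonneg hl (fun s => dS u t s - dS v t s)
  have iz := int_dt_nonneg hl (fun s => dT u t s - dT v t s)
  simp only [zero_mul, zero_add] at hsup hsup1 hadd hw2 i0 i1 iz
  rw [hadd]
  obtain ⟨F, hF⟩ : ∃ F, F = (∫ s in (0:ℝ)..l, dt (u t s - v t s) (u t s - v t s)) +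
    (∫ s in (0:ℝ)..l, dt (dS u t s - dS v t s) (dS u t s - dS v t s)) +
    ∫ s in (0:ℝ)..l, dt (dT u t s - dT v t s) (dT u t s - dT v t s) := ⟨_, rfl⟩
  rw [← hF]
  have hF0 : 0 ≤ F := by rw [hF]; positivity
  obtain ⟨S, hS⟩ : ∃ S, S = (1 / l + 1) * ((1 + 8 * K ^ 2) * F) := ⟨_, rfl⟩
  have hS0 : 0 ≤ S := by rw [hS]; positivity
  have hKF : 0 ≤ 8 * K ^ 2 * F := by positivity
  have s0 : ∀ s ∈ Icc 0 l, dt (u t s - v t s) (u t s - v t s) ≤ S := fun s hs => by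
    refine (hsup s hs).trans ?_
    rw [hS]; gcongr; linarith
  have s1 : ∀ s ∈ Icc 0 l, dt (dS u t s - dS v t s) (dS u t s - dS v t s) ≤ S := fun s hs => by
    refine (hsup1 s hs).trans ?_
    rw [hS]; gcongr; rw [hF] at hKF ⊢; linarith
  have hQ : Continuous (fun s => dt (u t s - v t s) (u t s - v t s)
      + dt (dS u t s - dS v t s) (dS u t s - dS v t s)
      + dt (dT u t s - dT v t s) (dT u t s - dT v t s)) :=
    ((w0.cdt t).add (w1.cdt t)).add (z0.cdt t)
  have hQi : (∫ s in (0:ℝ)..l, (dt (u t s - v t s) (u t s - v t s)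
      + dt (dS u t s - dS v t s) (dS u t s - dS v t s)
      + dt (dT u t s - dT v t s) (dT u t s - dT v t s))) = F := by
    have hc : Continuous (fun s => dt (u t s - v t s) (u t s - v t s)
      + dt (dS u t s - dS v t s) (dS u t s - dS v t s)) := (w0.cdt t).add (w1.cdt t)
    rw [intervalIntegral.integral_add (hc.intervalIntegrable _ _)
      ((z0.cdt t).intervalIntegrable _ _), hadd, hF]
  refine (lin3 hl 0 (40 * K ^ 3 * (1 + 8 * K ^ 2)) (40 * K ^ 3 * S) (40 * K ^ 3 * S) hQ
    (hu.sm.dT.dS.cdt t) (hv.sm.dT.dS.cdt t) (fun s hs => ?_)).trans ?_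
  · refine (G2_le hu hv hK (bv s hs).1 (bv s hs).2.1 (bu s hs).2.2 (bv s hs).2.2 (s0 s hs)
      (s1 s hs)).trans ?_
    have a1 := wss_le hu hv hK (bu s hs).1 (bv s hs).1 (bv s hs).2.1
    have a2 := mul_le_mul_of_nonneg_left a1 (by positivity : 0 ≤ 40 * K ^ 3)
    linarith
  · rw [hQi]
    have c1 : 40 * K ^ 3 * S * (∫ s in (0:ℝ)..l, dt (dS (dT u) t s) (dS (dT u) t s)) ≤
      40 * K ^ 3 * S * K := by gcongr
    have c2 : 40 * K ^ 3 * S * (∫ s in (0:ℝ)..l, dt (dS (dT v) t s) (dS (dT v) t s)) ≤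
      40 * K ^ 3 * S * K := by gcongr
    have c3 : 40 * K ^ 3 * S * K = 40 * K ^ 3 * ((1 / l + 1) * ((1 + 8 * K ^ 2) * F)) * K := by
      rw [hS]
    nlinarith

end SM

namespace SM

theorem mkSol {l : ℝ} {u : ℝ → ℝ → R3} (h1 : ContDiff ℝ (⊤ : ℕ∞) (fun p : ℝ × ℝ => u p.1 p.2))
    (h2 : ∀ t s : ℝ, u t (s + l) = u t s) (h3 : ∀ t s : ℝ, ‖u t s‖ = 1)
    (h4 : ∀ t s : ℝ, deriv (fun τ => u τ s) t =
      deriv (fun σ => cross3 (u t σ) (deriv (u t) σ)) s) : Sol l u where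
  sm := h1
  per := h2
  unit := fun t s => by rw [dt_self, h3]; norm_num
  eq := fun t s => by
    have hs : Sm u := h1
    have e := (hcr (hs.hS t s) (hs.dS.hS t s)).deriv
    have e0 : cross3 (dS u t s) (dS u t s) = 0 := by
      apply ext3 <;> simp only [cr0, cr1, cr2, PiLp.zero_apply] <;> ring
    rw [e0, zero_add] at e
    exact (h4 t s).trans e

theorem initBound {l M : ℝ} (hM : 0 < M) {u : ℝ → ℝ → R3}
    (h : Real.sqrt (∫ s in (0:ℝ)..l, ‖deriv (deriv (deriv (u 0))) s‖ ^ 2) ≤ M) :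
    (∫ s in (0:ℝ)..l, dt (dS (dS (dS u)) 0 s) (dS (dS (dS u)) 0 s)) ≤ M ^ 2 := by
  simp only [dt_self]
  exact (Real.sqrt_le_left hM.le).1 h

theorem main (l T M : ℝ) (hl : 0 < l) (hM : 0 < M) : ∃ C : ℝ, 0 < C ∧ ∀ u v : ℝ → ℝ → R3,
    Sol l u → Sol l v →
    (∫ s in (0:ℝ)..l, dt (dS (dS (dS u)) 0 s) (dS (dS (dS u)) 0 s) ≤ M) →
    (∫ s in (0:ℝ)..l, dt (dS (dS (dS v)) 0 s) (dS (dS (dS v)) 0 s) ≤ M) →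
    ∀ t ∈ Icc (-T) T,
      (∫ s in (0:ℝ)..l, (dt (u t s - v t s) (u t s - v t s)
        + dt (dS u t s - dS v t s) (dS u t s - dS v t s))) ≤
      C * (∫ s in (0:ℝ)..l, (dt (u 0 s - v 0 s) (u 0 s - v 0 s)
        + dt (dS u 0 s - dS v 0 s) (dS u 0 s - dS v 0 s))) ∧
      (∫ s in (0:ℝ)..l, (dt (u t s - v t s) (u t s - v t s)
        + dt (dS u t s - dS v t s) (dS u t s - dS v t s)
        + dt (dS (dS u) t s - dS (dS v) t s) (dS (dS u) t s - dS (dS v) t s))) ≤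
      C * (∫ s in (0:ℝ)..l, (dt (u 0 s - v 0 s) (u 0 s - v 0 s)
        + dt (dS u 0 s - dS v 0 s) (dS u 0 s - dS v 0 s)
        + dt (dS (dS u) 0 s - dS (dS v) 0 s) (dS (dS u) 0 s - dS (dS v) 0 s))) := by
  obtain ⟨K, hK, hap⟩ := apriori l T M hl hM
  obtain ⟨C1, hC1⟩ : ∃ x : ℝ, x = 1 + K + (1 / l + 1) * K := ⟨_, rfl⟩
  obtain ⟨C2, hC2⟩ : ∃ x : ℝ,
    x = 40 * K ^ 3 * (1 + 8 * K ^ 2) * (1 + 2 * (1 / l + 1) * K) := ⟨_, rfl⟩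
  have hC10 : 0 ≤ C1 := by rw [hC1]; positivity
  have hC20 : 0 ≤ C2 := by rw [hC2]; positivity
  refine ⟨exp (C1 * T) + (1 + 8 * K ^ 2) * (3 + 2 * K ^ 2) * exp ((C1 + C2) * T),
    by positivity, fun u v hu hv iu iv t ht => ?_⟩
  have au := hap u hu iu
  have av := hap v hv iv
  obtain ⟨E, hE⟩ : ∃ E : ℝ → ℝ, E = fun t => ∫ s in (0:ℝ)..l, (dt (u t s - v t s) (u t s - v t s)
      + dt (dS u t s - dS v t s) (dS u t s - dS v t s)) := ⟨_, rfl⟩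
  obtain ⟨Z, hZ⟩ : ∃ Z : ℝ → ℝ, Z = fun t => ∫ s in (0:ℝ)..l,
      dt (dT u t s - dT v t s) (dT u t s - dT v t s) := ⟨_, rfl⟩
  obtain ⟨N, hN⟩ : ∃ N : ℝ → ℝ, N = fun t => ∫ s in (0:ℝ)..l, (dt (u t s - v t s) (u t s - v t s)
      + dt (dS u t s - dS v t s) (dS u t s - dS v t s)
      + dt (dS (dS u) t s - dS (dS v) t s) (dS (dS u) t s - dS (dS v) t s)) := ⟨_, rfl⟩
  have hE0 : ∀ t, 0 ≤ E t := fun t => by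
    rw [hE]; exact intervalIntegral.integral_nonneg hl.le fun s _ =>
      add_nonneg (dt_nonneg _) (dt_nonneg _)
  have hN0 : ∀ t, 0 ≤ N t := fun t => by
    rw [hN]; exact intervalIntegral.integral_nonneg hl.le fun s _ =>
      add_nonneg (add_nonneg (dt_nonneg _) (dt_nonneg _)) (dt_nonneg _)
  have hZ0 : ∀ t, 0 ≤ Z t := fun t => by
    rw [hZ]; exact int_dt_nonneg hl _
  have dE := D1 hu hv
  have dZ := D2 hu hv
  have r1 := fun t (ht : t ∈ Icc (-T) T) => H1_rate hl hK hu hv (t := t)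
    (fun s hs => ((au t ht).1 s hs).1) (av t ht).2.2
  have r2 := fun t (ht : t ∈ Icc (-T) T) => H2_rate hl hK hu hv (t := t)
    (au t ht).1 (av t ht).1 (au t ht).2.1 (av t ht).2.1
  have eE : ∀ t, (∫ s in (0:ℝ)..l, (dt (u t s - v t s) (u t s - v t s)
      + dt (dS u t s - dS v t s) (dS u t s - dS v t s))) = E t := fun t => by rw [hE]
  have eZ : ∀ t, (∫ s in (0:ℝ)..l, dt (dT u t s - dT v t s) (dT u t s - dT v t s)) = Z t :=
    fun t => by rw [hZ]
  have eN : ∀ t, (∫ s in (0:ℝ)..l, (dt (u t s - v t s) (u t s - v t s)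
      + dt (dS u t s - dS v t s) (dS u t s - dS v t s)
      + dt (dS (dS u) t s - dS (dS v) t s) (dS (dS u) t s - dS (dS v) t s))) = N t :=
    fun t => by rw [hN]
  have w0 := hu.sm.sub hv.sm
  have w1 := hu.sm.dS.sub hv.sm.dS
  have w2 := hu.sm.dS.dS.sub hv.sm.dS.dS
  have z0 := hu.sm.dT.sub hv.sm.dT
  have cE : ∀ t, Continuous (fun s => dt (u t s - v t s) (u t s - v t s)
      + dt (dS u t s - dS v t s) (dS u t s - dS v t s)) := fun t => (w0.cdt t).add (w1.cdt t)
  have cN : ∀ t, Continuous (fun s => dt (u t s - v t s) (u t s - v t s)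
      + dt (dS u t s - dS v t s) (dS u t s - dS v t s)
      + dt (dS (dS u) t s - dS (dS v) t s) (dS (dS u) t s - dS (dS v) t s)) :=
    fun t => ((w0.cdt t).add (w1.cdt t)).add (w2.cdt t)
  have n1 : ∀ t ∈ Icc (-T) T, N t ≤ (1 + 8 * K ^ 2) * (E t + Z t) := fun t ht => by
    have h := (le_abs_self _).trans (lin3 hl 0 (1 + 8 * K ^ 2) (1 + 8 * K ^ 2) 0
      (cE t) (z0.cdt t) (z0.cdt t) (f := fun s => dt (u t s - v t s) (u t s - v t s)
      + dt (dS u t s - dS v t s) (dS u t s - dS v t s)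
      + dt (dS (dS u) t s - dS (dS v) t s) (dS (dS u) t s - dS (dS v) t s)) (fun s hs => by
        have p0 := dt_nonneg (u t s - v t s)
        have p1 := dt_nonneg (dS u t s - dS v t s)
        have p2 := dt_nonneg (dS (dS u) t s - dS (dS v) t s)
        have p3 := dt_nonneg (dT u t s - dT v t s)
        rw [abs_of_nonneg (by positivity)]
        have := wss_le hu hv hK ((au t ht).1 s hs).1 ((av t ht).1 s hs).1 ((av t ht).1 s hs).2.1
        linarith))
    rw [eN, eE, eZ] at h
    linarith
  have n2 : ∀ t ∈ Icc (-T) T, E t + Z t ≤ (3 + 2 * K ^ 2) * N t := fun t ht => by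
    have h := (le_abs_self _).trans (lin3 hl 0 (3 + 2 * K ^ 2) 0 0
      (cN t) (z0.cdt t) (z0.cdt t) (f := fun s => (dt (u t s - v t s) (u t s - v t s)
      + dt (dS u t s - dS v t s) (dS u t s - dS v t s))
      + dt (dT u t s - dT v t s) (dT u t s - dT v t s)) (fun s hs => by
        have p0 := dt_nonneg (u t s - v t s)
        have p1 := dt_nonneg (dS u t s - dS v t s)
        have p2 := dt_nonneg (dS (dS u) t s - dS (dS v) t s)
        have p3 := dt_nonneg (dT u t s - dT v t s)
        rw [abs_of_nonneg (by positivity)]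
        have := z_le hu hv ((av t ht).1 s hs).2.1
        have q1 := mul_nonneg (sq_nonneg K) p1
        have q2 := mul_nonneg (sq_nonneg K) p2
        linarith))
    rw [intervalIntegral.integral_add ((cE t).intervalIntegrable _ _)
      ((z0.cdt t).intervalIntegrable _ _), eN, eE, eZ] at h
    linarith
  have hT0 : (0:ℝ) ∈ Icc (-T) T := by
    have := ht.1.trans ht.2
    constructor <;> linarith
  have htT : |t| ≤ T := abs_le.2 ht
  have g1 := gronwall (f := E) (K := C1) (by rw [hE]; exact dE)
    (fun t ht => by have := r1 t ht; rwa [eE, ← hC1] at this) t ht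
  have g2 := gronwall (f := fun t => E t + Z t) (K := C1 + C2)
    (fun t => by
      have a := (dE t).add (dZ t)
      rw [hE, hZ]; exact a)
    (fun t ht => by
      have a := r1 t ht
      have b := r2 t ht
      rw [eE, ← hC1] at a
      rw [eE, eZ, ← hC2] at b
      refine (abs_add_le _ _).trans ?_
      have := mul_nonneg hC10 (hZ0 t)
      show _ ≤ (C1 + C2) * (E t + Z t)
      linarith) t ht
  rw [eE, eE, eN, eN]
  constructor
  · refine g1.trans ?_
    rw [mul_comm]
    refine mul_le_mul_of_nonneg_right ?_ (hE0 0)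
    have x1 : exp (C1 * |t|) ≤ exp (C1 * T) := exp_le_exp.2 (by gcongr)
    have x2 : 0 ≤ (1 + 8 * K ^ 2) * (3 + 2 * K ^ 2) * exp ((C1 + C2) * T) := by positivity
    linarith
  · have x1 : exp ((C1 + C2) * |t|) ≤ exp ((C1 + C2) * T) := exp_le_exp.2 (by gcongr)
    have x3 : 0 ≤ exp (C1 * T) * N 0 := mul_nonneg (exp_pos _).le (hN0 0)
    have x4 := hN0 0
    calc N t ≤ (1 + 8 * K ^ 2) * (E t + Z t) := n1 t ht
      _ ≤ (1 + 8 * K ^ 2) * ((E 0 + Z 0) * exp ((C1 + C2) * |t|)) := by gcongr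
      _ ≤ (1 + 8 * K ^ 2) * (((3 + 2 * K ^ 2) * N 0) * exp ((C1 + C2) * T)) := by
          gcongr
          exact n2 0 hT0
      _ ≤ _ := by linarith

end SM

end helpers

/-- Corollary A.6: `H¹` and `H²` stability for the difference of
two Schrödinger maps with `H³`-bounded initial data. -/
theorem stmt19
    (ℓ T M : ℝ) (hℓ : 0 < ℓ) (hT : 0 < T) (hM : 0 < M) :
    ∃ C : ℝ, 0 < C ∧
      ∀ u v : ℝ → ℝ → R3,
        ContDiff ℝ (⊤ : ℕ∞) (fun p : ℝ × ℝ => u p.1 p.2) →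
        ContDiff ℝ (⊤ : ℕ∞) (fun p : ℝ × ℝ => v p.1 p.2) →
        (∀ t s : ℝ, u t (s + ℓ) = u t s) →
        (∀ t s : ℝ, v t (s + ℓ) = v t s) →
        (∀ t s : ℝ, ‖u t s‖ = 1) →
        (∀ t s : ℝ, ‖v t s‖ = 1) →
        (∀ t s : ℝ,
          deriv (fun τ => u τ s) t =
            deriv (fun σ => cross3 (u t σ) (deriv (u t) σ)) s) →
        (∀ t s : ℝ,
          deriv (fun τ => v τ s) t =
            deriv (fun σ => cross3 (v t σ) (deriv (v t) σ)) s) →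
        Real.sqrt (∫ s in (0:ℝ)..ℓ, ‖deriv (deriv (deriv (u 0))) s‖ ^ 2) ≤ M →
        Real.sqrt (∫ s in (0:ℝ)..ℓ, ‖deriv (deriv (deriv (v 0))) s‖ ^ 2) ≤ M →
        ∀ t ∈ Set.Icc (-T) T,
          ((∫ s in (0:ℝ)..ℓ, (‖u t s - v t s‖ ^ 2 + ‖deriv (u t) s - deriv (v t) s‖ ^ 2)) ≤
            C * ∫ s in (0:ℝ)..ℓ,
              (‖u 0 s - v 0 s‖ ^ 2 + ‖deriv (u 0) s - deriv (v 0) s‖ ^ 2)) ∧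
          ((∫ s in (0:ℝ)..ℓ, (‖u t s - v t s‖ ^ 2 + ‖deriv (u t) s - deriv (v t) s‖ ^ 2
              + ‖deriv (deriv (u t)) s - deriv (deriv (v t)) s‖ ^ 2)) ≤
            C * ∫ s in (0:ℝ)..ℓ, (‖u 0 s - v 0 s‖ ^ 2 + ‖deriv (u 0) s - deriv (v 0) s‖ ^ 2
              + ‖deriv (deriv (u 0)) s - deriv (deriv (v 0)) s‖ ^ 2)) := by
  obtain ⟨C, hC, h⟩ := SM.main ℓ T (M ^ 2) hℓ (by positivity)
  refine ⟨C, hC, fun u v h1 h2 h3 h4 h5 h6 h7 h8 h9 h10 t ht => ?_⟩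
  have k := h u v (SM.mkSol h1 h3 h5 h7) (SM.mkSol h2 h4 h6 h8) (SM.initBound hM h9)
    (SM.initBound hM h10) t ht
  simp only [SM.dt_self] at k
  exact k
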